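/- arXiv:2012.03020 — 4 statements merged into one kernel-verified Lean document; each statement's English description precedes it below -/
import Mathlib

section
/- For 3-periodic billiard orbits in the ellipse with semi-axes a > b > 0, the perimeter equals L = 2(δ + a² + b²)·√(2δ − a² − b²)/c², where δ = √(a⁴ − a²b² + b⁴) and c² = a² − b². -/
noncomputable section

namespace BilliardInv

/-- A point of the plane. -/
abbrev Pt := ℝ × ℝ

/-- Euclidean dot product. -/
def dot (p q : Pt) : ℝ := p.1 * q.1 + p.2 * q.2

/-- Euclidean distance. -/
def dst (p q : Pt) : ℝ := Real.sqrt ((p.1 - q.1) ^ 2 + (p.2 - q.2) ^ 2)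

/-- Membership in the ellipse x²/a² + y²/b² = 1. -/
def onEllipse (a b : ℝ) (p : Pt) : Prop := p.1 ^ 2 / a ^ 2 + p.2 ^ 2 / b ^ 2 = 1

/-- Half the gradient of f(x,y) = x²/a² + y²/b² (an outward normal direction). -/
def nrm (a b : ℝ) (p : Pt) : Pt := (p.1 / a ^ 2, p.2 / b ^ 2)

/-- Unit vector pointing from `v` toward `q`. -/
def udir (v q : Pt) : Pt := (dst v q)⁻¹ • (q - v)

/-- The billiard reflection law at vertex `v` with neighboring vertices `q`, `r`:
the two adjacent sides make equal angles with the ellipse normal at `v`. -/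
def reflectAt (a b : ℝ) (q v r : Pt) : Prop :=
  dot (udir v q) (nrm a b v) = dot (udir v r) (nrm a b v)

/-- A 3-periodic billiard orbit in the ellipse with semi-axes `a > b > 0`:
a nondegenerate triangle inscribed in the ellipse obeying the reflection
law at each vertex. -/
structure Orbit3 (a b : ℝ) : Type where
  P1 : Pt
  P2 : Pt
  P3 : Pt
  h1 : onEllipse a b P1
  h2 : onEllipse a b P2
  h3 : onEllipse a b P3
  d12 : P1 ≠ P2
  d23 : P2 ≠ P3
  d31 : P3 ≠ P1
  r1 : reflectAt a b P3 P1 P2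
  r2 : reflectAt a b P1 P2 P3
  r3 : reflectAt a b P2 P3 P1

/-- Inversion of `p` with respect to the circle of radius `ρ` centered at `f`. -/
def inva (ρ : ℝ) (f p : Pt) : Pt :=
  f + (ρ ^ 2 / ((p.1 - f.1) ^ 2 + (p.2 - f.2) ^ 2)) • (p - f)

/-- Unsigned area of a triangle. -/
def area (A B C : Pt) : ℝ :=
  |(B.1 - A.1) * (C.2 - A.2) - (B.2 - A.2) * (C.1 - A.1)| / 2

/-- The point with barycentric coordinates wA : wB : wC w.r.t. triangle ABC. -/
def bary (wA wB wC : ℝ) (A B C : Pt) : Pt :=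
  (wA + wB + wC)⁻¹ • (wA • A + wB • B + wC • C)

/-- Side length a = |BC|. -/
def sA (A B C : Pt) : ℝ := dst B C
/-- Side length b = |CA|. -/
def sB (A B C : Pt) : ℝ := dst C A
/-- Side length c = |AB|. -/
def sC (A B C : Pt) : ℝ := dst A B

/-- Incenter X(1). -/
def incenter (A B C : Pt) : Pt := bary (sA A B C) (sB A B C) (sC A B C) A B C

/-- Barycenter (centroid) X(2). -/
def centroid (A B C : Pt) : Pt := bary 1 1 1 A B C

/-- Circumcenter X(3), via its barycentric coordinates a²(b²+c²−a²) : · : ·. -/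
def circumcenter (A B C : Pt) : Pt :=
  bary (sA A B C ^ 2 * (sB A B C ^ 2 + sC A B C ^ 2 - sA A B C ^ 2))
       (sB A B C ^ 2 * (sC A B C ^ 2 + sA A B C ^ 2 - sB A B C ^ 2))
       (sC A B C ^ 2 * (sA A B C ^ 2 + sB A B C ^ 2 - sC A B C ^ 2)) A B C

/-- Orthocenter X(4) = A + B + C − 2·(circumcenter). -/
def orthocenter (A B C : Pt) : Pt := A + B + C - (2 : ℝ) • circumcenter A B C

/-- Nine-point center X(5): midpoint of circumcenter and orthocenter. -/
def ninePointCenter (A B C : Pt) : Pt :=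
  ((1 : ℝ) / 2) • (circumcenter A B C + orthocenter A B C)

/-- Gergonne point X(7), barycentrics 1/(b+c−a) : 1/(c+a−b) : 1/(a+b−c). -/
def gergonne (A B C : Pt) : Pt :=
  bary (sB A B C + sC A B C - sA A B C)⁻¹
       (sC A B C + sA A B C - sB A B C)⁻¹
       (sA A B C + sB A B C - sC A B C)⁻¹ A B C

/-- Mittenpunkt X(9), barycentrics a(b+c−a) : b(c+a−b) : c(a+b−c). -/
def mittenpunkt (A B C : Pt) : Pt :=
  bary (sA A B C * (sB A B C + sC A B C - sA A B C))
       (sB A B C * (sC A B C + sA A B C - sB A B C))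
       (sC A B C * (sA A B C + sB A B C - sC A B C)) A B C

/-- Feuerbach point X(11), barycentrics (b+c−a)(b−c)² : · : ·. -/
def feuerbach (A B C : Pt) : Pt :=
  bary ((sB A B C + sC A B C - sA A B C) * (sB A B C - sC A B C) ^ 2)
       ((sC A B C + sA A B C - sB A B C) * (sC A B C - sA A B C) ^ 2)
       ((sA A B C + sB A B C - sC A B C) * (sA A B C - sB A B C) ^ 2) A B C

/-- Triangle center X(100), barycentrics a/(b−c) : b/(c−a) : c/(a−b). -/
def X100 (A B C : Pt) : Pt :=
  bary (sA A B C / (sB A B C - sC A B C))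
       (sB A B C / (sC A B C - sA A B C))
       (sC A B C / (sA A B C - sB A B C)) A B C

/-- Orthogonal projection of `Q` onto the line through `A` and `B`. -/
def projLine (Q A B : Pt) : Pt :=
  A + (dot (Q - A) (B - A) / dot (B - A) (B - A)) • (B - A)

/-- Unsigned area of the pedal triangle of `Q` w.r.t. triangle `A B C`. -/
def pedalArea (Q A B C : Pt) : ℝ :=
  area (projLine Q A B) (projLine Q B C) (projLine Q C A)

end BilliardInv

open BilliardInv Real

theorem field_aux {K : Type*} [Field K] (x y z u v w p g : K)
    (hx : x * u = 1) (hy : y * v = 1) (hz : z * w = 1)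
    (hxy : x ≠ y) (hyz : y ≠ z) (hzx : z ≠ x)
    (h1 : x * v + y * u - p * (x * y + u * v) = 2 * g)
    (h2 : y * w + z * v - p * (y * z + v * w) = 2 * g)
    (h3 : z * u + x * w - p * (z * x + w * u) = 2 * g) :
    1 + 2 * g + p * (x * y + y * z + z * x) = 0 ∧ x + y + z + p * (x * y * z) = 0 := by
  have F1 : x ^ 2 + y ^ 2 - p * (x ^ 2 * y ^ 2 + 1) - 2 * g * (x * y) = 0 := by
    linear_combination (x * y) * h1 - (y ^ 2 - p * (y * v)) * hx - (x ^ 2 - p) * hy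
  have F2 : y ^ 2 + z ^ 2 - p * (y ^ 2 * z ^ 2 + 1) - 2 * g * (y * z) = 0 := by
    linear_combination (y * z) * h2 - (z ^ 2 - p * (z * w)) * hy - (y ^ 2 - p) * hz
  have F3 : z ^ 2 + x ^ 2 - p * (z ^ 2 * x ^ 2 + 1) - 2 * g * (z * x) = 0 := by
    linear_combination (z * x) * h3 - (x ^ 2 - p * (x * u)) * hz - (z ^ 2 - p) * hx
  have G1 : (y + z) * (1 - p * x ^ 2) - 2 * g * x = 0 := by
    apply mul_left_cancel₀ (sub_ne_zero.2 hyz)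
    linear_combination F1 - F3
  have G2 : (z + x) * (1 - p * y ^ 2) - 2 * g * y = 0 := by
    apply mul_left_cancel₀ (sub_ne_zero.2 hzx)
    linear_combination F2 - F1
  have E2 : 1 + 2 * g + p * (x * y + y * z + z * x) = 0 := by
    apply mul_left_cancel₀ (sub_ne_zero.2 hxy)
    linear_combination G2 - G1
  exact ⟨E2, by linear_combination G1 + x * E2⟩

theorem real_aux (c1 s1 c2 s2 c3 s3 p g : ℝ)
    (e1 : c1 ^ 2 + s1 ^ 2 = 1) (e2 : c2 ^ 2 + s2 ^ 2 = 1) (e3 : c3 ^ 2 + s3 ^ 2 = 1)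
    (n12 : ¬ (c1 = c2 ∧ s1 = s2)) (n23 : ¬ (c2 = c3 ∧ s2 = s3)) (n31 : ¬ (c3 = c1 ∧ s3 = s1))
    (h1 : (1 - p) * (c1 * c2) + (1 + p) * (s1 * s2) = g)
    (h2 : (1 - p) * (c2 * c3) + (1 + p) * (s2 * s3) = g)
    (h3 : (1 - p) * (c3 * c1) + (1 + p) * (s3 * s1) = g) :
    p ^ 2 = 1 + 2 * g ∧ (c1 + c2 + c3) ^ 2 + (s1 + s2 + s3) ^ 2 = p ^ 2 := by
  have ne : ∀ c s c' s' : ℝ, ¬ (c = c' ∧ s = s') → (⟨c, s⟩ : ℂ) ≠ ⟨c', s'⟩ := by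
    intro c s c' s' h h'
    exact h ⟨congrArg Complex.re h', congrArg Complex.im h'⟩
  have mu : ∀ c s : ℝ, c ^ 2 + s ^ 2 = 1 → (⟨c, s⟩ : ℂ) * ⟨c, -s⟩ = 1 := by
    intro c s h
    apply Complex.ext
    · simp; linarith
    · simp; ring
  have mu' : ∀ c s : ℝ, c ^ 2 + s ^ 2 = 1 → (⟨c, -s⟩ : ℂ) * ⟨c, s⟩ = 1 := by
    intro c s h
    rw [mul_comm]; exact mu c s h
  have eqn : ∀ c s c' s' : ℝ, (1 - p) * (c * c') + (1 + p) * (s * s') = g →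
      (⟨c, s⟩ : ℂ) * ⟨c', -s'⟩ + ⟨c', s'⟩ * ⟨c, -s⟩
        - (p : ℂ) * (⟨c, s⟩ * ⟨c', s'⟩ + ⟨c, -s⟩ * ⟨c', -s'⟩) = 2 * (g : ℂ) := by
    intro c s c' s' h
    apply Complex.ext
    · simp; linear_combination 2 * h
    · simp; ring
  obtain ⟨A, B⟩ := field_aux (⟨c1, s1⟩ : ℂ) ⟨c2, s2⟩ ⟨c3, s3⟩ ⟨c1, -s1⟩ ⟨c2, -s2⟩ ⟨c3, -s3⟩ p g
    (mu _ _ e1) (mu _ _ e2) (mu _ _ e3) (ne _ _ _ _ n12) (ne _ _ _ _ n23) (ne _ _ _ _ n31)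
    (eqn _ _ _ _ h1) (eqn _ _ _ _ h2) (eqn _ _ _ _ h3)
  have A1 := congrArg Complex.re A
  have A2 := congrArg Complex.im A
  have B1 := congrArg Complex.re B
  have B2 := congrArg Complex.im B
  simp at A1 A2 B1 B2
  set X := c1 * c2 * c3 - s1 * s2 * c3 - c1 * s2 * s3 - s1 * c2 * s3 with hX
  set Y := c1 * c2 * s3 - s1 * s2 * s3 + c1 * s2 * c3 + s1 * c2 * c3 with hY
  have N : X ^ 2 + Y ^ 2 = 1 := by
    have : X ^ 2 + Y ^ 2 = (c1 ^ 2 + s1 ^ 2) * (c2 ^ 2 + s2 ^ 2) * (c3 ^ 2 + s3 ^ 2) := by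
      rw [hX, hY]; ring
    rw [this, e1, e2, e3]; ring
  have C1 : c1 + c2 + c3 = - p * X := by rw [hX]; linear_combination B1
  have C2 : s1 + s2 + s3 = - p * Y := by rw [hY]; linear_combination B2
  refine ⟨?_, by rw [C1, C2]; linear_combination p ^ 2 * N⟩
  have R : c1 * c2 - s1 * s2 + (c2 * c3 - s2 * s3) + (c3 * c1 - s3 * s1)
      = X * (c1 + c2 + c3) + Y * (s1 + s2 + s3) := by
    rw [hX, hY]
    linear_combination -(c2 * c3 - s2 * s3) * e1 - (c1 * c3 - s1 * s3) * e2 - (c1 * c2 - s1 * s2) * e3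
  rw [C1, C2] at R
  linear_combination -A1 + p * R - p ^ 2 * N

theorem chord_aux (a b c s c' s' d J : ℝ) (e : c ^ 2 + s ^ 2 = 1) (e' : c' ^ 2 + s' ^ 2 = 1)
    (hd : d ^ 2 = a ^ 2 * (c - c') ^ 2 + b ^ 2 * (s - s') ^ 2)
    (hJ : d * J = 1 - (c * c' + s * s')) (hn : ¬ (c = c' ∧ s = s')) :
    (1 - J ^ 2 * (a ^ 2 - b ^ 2)) * (c * c') + (1 + J ^ 2 * (a ^ 2 - b ^ 2)) * (s * s')
      = 1 - J ^ 2 * (a ^ 2 + b ^ 2) := by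
  have hne : 1 - (c * c' + s * s') ≠ 0 := by
    intro h
    apply hn
    have : (c - c') ^ 2 + (s - s') ^ 2 = 0 := by linear_combination e + e' + 2 * h
    constructor <;> nlinarith [sq_nonneg (c - c'), sq_nonneg (s - s')]
  have i1 : (c - c') ^ 2 = (1 - (c * c' + s * s')) * (1 - (c * c' - s * s')) := by
    linear_combination s' ^ 2 * e - (c ^ 2 - 1) * e'
  have i2 : (s - s') ^ 2 = (1 - (c * c' + s * s')) * (1 + (c * c' - s * s')) := by
    linear_combination c' ^ 2 * e - (s ^ 2 - 1) * e'
  apply mul_left_cancel₀ hne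
  have h2 : d ^ 2 * J ^ 2 = (1 - (c * c' + s * s')) ^ 2 := by rw [← hJ]; ring
  rw [hd, i1, i2] at h2
  linear_combination h2

theorem eq_aux (c s c' s' : ℝ) (e : c ^ 2 + s ^ 2 = 1) (e' : c' ^ 2 + s' ^ 2 = 1)
    (h : 1 - (c * c' + s * s') ≤ 0) : c = c' ∧ s = s' := by
  have h1 : (c - c') ^ 2 + (s - s') ^ 2 ≤ 0 := by nlinarith
  have h2 := sq_nonneg (c - c')
  have h3 := sq_nonneg (s - s')
  have h4 : (c - c') ^ 2 = 0 := by linarith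
  have h5 : (s - s') ^ 2 = 0 := by linarith
  exact ⟨sub_eq_zero.1 (pow_eq_zero_iff two_ne_zero |>.1 h4),
    sub_eq_zero.1 (pow_eq_zero_iff two_ne_zero |>.1 h5)⟩

theorem dst_comm' (p q : Pt) : dst p q = dst q p := by
  unfold dst; congr 1; ring

theorem dst_pos' (p q : Pt) (h : p ≠ q) : 0 < dst p q := by
  unfold dst
  apply Real.sqrt_pos.2
  by_contra hc
  apply h
  apply Prod.ext <;> nlinarith [sq_nonneg (p.1 - q.1), sq_nonneg (p.2 - q.2)]

theorem dot_aux (a b : ℝ) (v q : Pt) (hv : onEllipse a b v) :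
    dot (udir v q) (nrm a b v)
      = - ((dst v q)⁻¹ * (1 - (v.1 / a * (q.1 / a) + v.2 / b * (q.2 / b)))) := by
  unfold onEllipse at hv
  simp only [dot, udir, nrm, Prod.smul_fst, Prod.smul_snd, Prod.fst_sub, Prod.snd_sub, smul_eq_mul]
  rw [← hv]
  ring

theorem dst_sq' (a b : ℝ) (ha : a ≠ 0) (hb : b ≠ 0) (p q : Pt) :
    dst p q ^ 2 = a ^ 2 * (p.1 / a - q.1 / a) ^ 2 + b ^ 2 * (p.2 / b - q.2 / b) ^ 2 := by
  unfold dst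
  rw [Real.sq_sqrt (by positivity)]
  field_simp

/-- the perimeter of every 3-periodic billiard orbit equals
L = 2(δ + a² + b²)·√(2δ − a² − b²)/c². -/
theorem perimeter_three_periodics (a b : ℝ) (hab : a > b) (hb : b > 0)
    (T : Orbit3 a b) :
    let δ : ℝ := Real.sqrt (a ^ 4 - a ^ 2 * b ^ 2 + b ^ 4)
    dst T.P1 T.P2 + dst T.P2 T.P3 + dst T.P3 T.P1 =
      2 * (δ + a ^ 2 + b ^ 2) * Real.sqrt (2 * δ - a ^ 2 - b ^ 2) / (a ^ 2 - b ^ 2) := by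
  intro δ
  obtain ⟨P, Q, R, h1, h2, h3, d12, d23, d31, r1, r2, r3⟩ := T
  simp only
  have ha : a > 0 := hb.trans hab
  have p12 := dst_pos' P Q d12
  have p23 := dst_pos' Q R d23
  have p31 := dst_pos' R P d31
  unfold reflectAt at r1 r2 r3
  rw [dot_aux a b _ _ h1, dot_aux a b _ _ h1, dst_comm' P R] at r1
  rw [dot_aux a b _ _ h2, dot_aux a b _ _ h2, dst_comm' Q P] at r2
  have q12 := dst_sq' a b ha.ne' hb.ne' P Q
  have q23 := dst_sq' a b ha.ne' hb.ne' Q R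
  have q31 := dst_sq' a b ha.ne' hb.ne' R P
  have ne : ∀ p q : Pt, p ≠ q → ¬ (p.1 / a = q.1 / a ∧ p.2 / b = q.2 / b) := by
    rintro p q h ⟨h', h''⟩
    apply h
    exact Prod.ext ((div_left_inj' ha.ne').1 h') ((div_left_inj' hb.ne').1 h'')
  have n12 := ne _ _ d12
  have n23 := ne _ _ d23
  have n31 := ne _ _ d31
  have el : ∀ p : Pt, onEllipse a b p → (p.1 / a) ^ 2 + (p.2 / b) ^ 2 = 1 := by
    intro p h
    unfold onEllipse at h
    rw [div_pow, div_pow]; exact h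
  have e1 := el _ h1
  have e2 := el _ h2
  have e3 := el _ h3
  clear el ne h1 h2 h3 d12 d23 d31 r3
  generalize P.1 / a = c1 at *
  generalize P.2 / b = s1 at *
  generalize Q.1 / a = c2 at *
  generalize Q.2 / b = s2 at *
  generalize R.1 / a = c3 at *
  generalize R.2 / b = s3 at *
  generalize dst P Q = l12 at *
  generalize dst Q R = l23 at *
  generalize dst R P = l31 at *
  obtain ⟨J, hJ⟩ : ∃ J, J = l12⁻¹ * (1 - (c1 * c2 + s1 * s2)) := ⟨_, rfl⟩
  have j12 : l12 * J = 1 - (c1 * c2 + s1 * s2) := by rw [hJ]; field_simp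
  have j23 : l23 * J = 1 - (c2 * c3 + s2 * s3) := by
    have : J = l23⁻¹ * (1 - (c2 * c3 + s2 * s3)) := by rw [hJ]; linear_combination -r2
    rw [this]; field_simp
  have j31 : l31 * J = 1 - (c3 * c1 + s3 * s1) := by
    have : J = l31⁻¹ * (1 - (c3 * c1 + s3 * s1)) := by rw [hJ]; linear_combination r1
    rw [this]; field_simp
  have Jpos : 0 < J := by
    have : 0 < l12 * J := by
      rw [j12]
      by_contra hc
      apply n12
      exact eq_aux _ _ _ _ e1 e2 (not_lt.1 hc)
    exact (mul_pos_iff_of_pos_left p12).1 this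
  have k12 := chord_aux a b _ _ _ _ _ J e1 e2 q12 j12 n12
  have k23 := chord_aux a b _ _ _ _ _ J e2 e3 q23 j23 n23
  have k31 := chord_aux a b _ _ _ _ _ J e3 e1 q31 j31 n31
  obtain ⟨A, B⟩ := real_aux _ _ _ _ _ _ _ _ e1 e2 e3 n12 n23 n31 k12 k23 k31
  have c2pos : 0 < a ^ 2 - b ^ 2 := sub_pos.2 (pow_lt_pow_left₀ hab hb.le two_ne_zero)
  have hδ : δ = (J ^ 2 * (a ^ 2 - b ^ 2) ^ 2 + a ^ 2 + b ^ 2) / 2 := by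
    have : a ^ 4 - a ^ 2 * b ^ 2 + b ^ 4
        = ((J ^ 2 * (a ^ 2 - b ^ 2) ^ 2 + a ^ 2 + b ^ 2) / 2) ^ 2 := by
      linear_combination -(a ^ 2 - b ^ 2) ^ 2 / 4 * A
    change Real.sqrt _ = _
    rw [this, Real.sqrt_sq (by positivity)]
  have hs : Real.sqrt (2 * δ - a ^ 2 - b ^ 2) = J * (a ^ 2 - b ^ 2) := by
    rw [hδ, show 2 * ((J ^ 2 * (a ^ 2 - b ^ 2) ^ 2 + a ^ 2 + b ^ 2) / 2) - a ^ 2 - b ^ 2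
      = (J * (a ^ 2 - b ^ 2)) ^ 2 by ring, Real.sqrt_sq (by positivity)]
  rw [hs, eq_div_iff c2pos.ne', hδ]
  apply mul_left_cancel₀ Jpos.ne'
  have S : J * (l12 + l23 + l31) = 3 + J ^ 2 * (a ^ 2 + b ^ 2) := by
    linear_combination j12 + j23 + j31 - B / 2 - A / 2 + (e1 + e2 + e3) / 2
  linear_combination (a ^ 2 - b ^ 2) * S - (a ^ 2 - b ^ 2) * A
end
end

section
/- The confocal caustic of the 3-periodic billiard family in the ellipse x²/a² + y²/b² = 1 is the ellipse x²/a''² + y²/b''² = 1 with a'' = a(δ − b²)/(a² − b²) and b'' = b(a² − δ)/(a² − b²), where δ = √(a⁴ − a²b² + b⁴). -/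
noncomputable section

open BilliardInv Real


namespace CausticAux

lemma prod_aux (m n C x y z w : ℝ) (h1 : x ^ 2 + y ^ 2 = 1) (h2 : z ^ 2 + w ^ 2 = 1)
    (e1 : m * x + n * y = C) (e2 : m * z + n * w = C) (hne : ¬ (x = z ∧ y = w)) :
    (m ^ 2 + n ^ 2) * (x * z) = C ^ 2 - n ^ 2 := by
  by_cases hx : x = z
  · subst hx
    have hy : y ≠ w := fun h => hne ⟨rfl, h⟩
    have hs : (y - w) * (y + w) = 0 := by linear_combination h1 - h2
    have hn : n * (y - w) = 0 := by linear_combination e1 - e2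
    have hn0 : n = 0 := by
      rcases mul_eq_zero.1 hn with h | h
      · exact h
      · exact absurd (sub_eq_zero.1 h) hy
    subst hn0
    rw [← e1]; ring
  · have hx' : x - z ≠ 0 := sub_ne_zero.2 hx
    have q1 : (m ^ 2 + n ^ 2) * x ^ 2 - 2 * C * m * x + C ^ 2 - n ^ 2 = 0 := by
      rw [← e1]; linear_combination n ^ 2 * h1
    have q2 : (m ^ 2 + n ^ 2) * z ^ 2 - 2 * C * m * z + C ^ 2 - n ^ 2 = 0 := by
      rw [← e2]; linear_combination n ^ 2 * h2
    apply mul_left_cancel₀ hx'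
    linear_combination z * q1 - x * q2

lemma pt_aux (A B C x1 y1 x2 y2 x3 y3 : ℝ) (h1 : x1 ^ 2 + y1 ^ 2 = 1) (h2 : x2 ^ 2 + y2 ^ 2 = 1)
    (h3 : x3 ^ 2 + y3 ^ 2 = 1)
    (e12 : A * (x1 * x2) + B * (y1 * y2) = C) (e13 : A * (x1 * x3) + B * (y1 * y3) = C)
    (e23 : A * (x2 * x3) + B * (y2 * y3) = C) (hne : ¬ (x2 = x3 ∧ y2 = y3)) :
    A ^ 2 * (B + C) * x1 ^ 2 + B ^ 2 * (A + C) * y1 ^ 2 = (A + B) * C ^ 2 := by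
  have p := prod_aux (A * x1) (B * y1) C x2 y2 x3 y3 h2 h3 (by linarith) (by linarith) hne
  have q := prod_aux (B * y1) (A * x1) C y2 x2 y3 x3 (by linarith) (by linarith)
    (by linarith) (by linarith) (fun h => hne ⟨h.2, h.1⟩)
  linear_combination A * p + B * q - ((A * x1) ^ 2 + (B * y1) ^ 2) * e23

lemma core (A B C x1 y1 x2 y2 x3 y3 : ℝ) (h1 : x1 ^ 2 + y1 ^ 2 = 1) (h2 : x2 ^ 2 + y2 ^ 2 = 1)
    (h3 : x3 ^ 2 + y3 ^ 2 = 1)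
    (e12 : A * (x1 * x2) + B * (y1 * y2) = C) (e13 : A * (x1 * x3) + B * (y1 * y3) = C)
    (e23 : A * (x2 * x3) + B * (y2 * y3) = C)
    (n12 : ¬ (x1 = x2 ∧ y1 = y2)) (n13 : ¬ (x1 = x3 ∧ y1 = y3)) (n23 : ¬ (x2 = x3 ∧ y2 = y3))
    (hB : B ≠ 0) (hAB : A ≠ B) : A * B + C * (A + B) = 0 := by
  have E1 := pt_aux A B C x1 y1 x2 y2 x3 y3 h1 h2 h3 e12 e13 e23 n23
  have E2 := pt_aux A B C x2 y2 x1 y1 x3 y3 h2 h1 h3 (by linarith) e23 e13 n13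
  have E3 := pt_aux A B C x3 y3 x1 y1 x2 y2 h3 h1 h2 (by linarith) (by linarith) e12 n12
  by_contra hne
  have hpq : (A - B) * (A * B + C * (A + B)) ≠ 0 := mul_ne_zero (sub_ne_zero.2 hAB) hne
  have s12 : x1 ^ 2 = x2 ^ 2 := by
    apply mul_left_cancel₀ hpq
    linear_combination E1 - E2 - B ^ 2 * (A + C) * (h1 - h2)
  have s13 : x1 ^ 2 = x3 ^ 2 := by
    apply mul_left_cancel₀ hpq
    linear_combination E1 - E3 - B ^ 2 * (A + C) * (h1 - h3)
  have t12 : y1 ^ 2 = y2 ^ 2 := by linarith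
  have t13 : y1 ^ 2 = y3 ^ 2 := by linarith
  have key : y1 = 0 ∨ B * y1 ^ 2 = 0 := by
    rcases sq_eq_sq_iff_eq_or_eq_neg.1 s12 with a | a <;>
    rcases sq_eq_sq_iff_eq_or_eq_neg.1 s13 with b | b <;>
    rcases sq_eq_sq_iff_eq_or_eq_neg.1 t12 with c | c <;>
    rcases sq_eq_sq_iff_eq_or_eq_neg.1 t13 with d | d <;>
    obtain rfl : x2 = _ := (by first | exact a.symm | exact (neg_eq_iff_eq_neg.2 a).symm) <;>
    obtain rfl : x3 = _ := (by first | exact b.symm | exact (neg_eq_iff_eq_neg.2 b).symm) <;>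
    obtain rfl : y2 = _ := (by first | exact c.symm | exact (neg_eq_iff_eq_neg.2 c).symm) <;>
    obtain rfl : y3 = _ := (by first | exact d.symm | exact (neg_eq_iff_eq_neg.2 d).symm) <;>
    first
      | exact absurd ⟨rfl, rfl⟩ n12
      | exact absurd ⟨rfl, rfl⟩ n13
      | exact absurd ⟨rfl, rfl⟩ n23
      | (right; linarith)
  have hy : y1 = 0 := by
    rcases key with h | h
    · exact h
    · rcases mul_eq_zero.1 h with h | h
      · exact absurd h hB
      · exact pow_eq_zero_iff (two_ne_zero) |>.1 h
  have hy2 : y2 = 0 := by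
    rw [hy] at t12; exact pow_eq_zero_iff (two_ne_zero) |>.1 (by linarith)
  have hy3 : y3 = 0 := by
    rw [hy] at t13; exact pow_eq_zero_iff (two_ne_zero) |>.1 (by linarith)
  rcases sq_eq_sq_iff_eq_or_eq_neg.1 s12 with a | a
  · exact n12 ⟨a, by rw [hy, hy2]⟩
  · rcases sq_eq_sq_iff_eq_or_eq_neg.1 s13 with b | b
    · exact n13 ⟨b, by rw [hy, hy3]⟩
    · exact n23 ⟨by linarith, by rw [hy2, hy3]⟩

/-- squared distance -/
def dd (p q : Pt) : ℝ := (p.1 - q.1) ^ 2 + (p.2 - q.2) ^ 2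

/-- bilinear form of the ellipse -/
def cc (a b : ℝ) (p q : Pt) : ℝ := (p.1 / a) * (q.1 / a) + (p.2 / b) * (q.2 / b)

lemma dd_pos {p q : Pt} (h : p ≠ q) : 0 < dd p q := by
  unfold dd
  by_contra hc
  apply h
  have h1 : (p.1 - q.1) ^ 2 = 0 := by nlinarith [sq_nonneg (p.1 - q.1), sq_nonneg (p.2 - q.2)]
  have h2 : (p.2 - q.2) ^ 2 = 0 := by nlinarith [sq_nonneg (p.1 - q.1), sq_nonneg (p.2 - q.2)]
  exact Prod.ext (sub_eq_zero.1 (pow_eq_zero_iff two_ne_zero |>.1 h1))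
    (sub_eq_zero.1 (pow_eq_zero_iff two_ne_zero |>.1 h2))

lemma ell (a b : ℝ) (p : Pt) (h : onEllipse a b p) : (p.1 / a) ^ 2 + (p.2 / b) ^ 2 = 1 := by
  rw [div_pow, div_pow]; exact h

lemma dot_udir (a b : ℝ) (v q : Pt) (h : onEllipse a b v) :
    dot (udir v q) (nrm a b v) = (dst v q)⁻¹ * (cc a b v q - 1) := by
  have h' := ell a b v h
  simp only [dot, udir, nrm, cc, Prod.smul_fst, Prod.smul_snd, Prod.fst_sub, Prod.snd_sub,
    smul_eq_mul]
  rw [← h']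
  simp only [div_eq_mul_inv, ← inv_pow]
  ring

lemma refl_aux (a b : ℝ) (q v r : Pt) (h : onEllipse a b v) (hr : reflectAt a b q v r) :
    (1 - cc a b v q) ^ 2 / dd v q = (1 - cc a b v r) ^ 2 / dd v r := by
  unfold reflectAt at hr
  rw [dot_udir a b v q h, dot_udir a b v r h] at hr
  have hq : dst v q ^ 2 = dd v q := Real.sq_sqrt (by positivity)
  have hr' : dst v r ^ 2 = dd v r := Real.sq_sqrt (by positivity)
  have := congrArg (· ^ 2) hr
  simp only [mul_pow, inv_pow, hq, hr'] at this
  rw [div_eq_inv_mul, div_eq_inv_mul]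
  linear_combination this

lemma cc_comm (a b : ℝ) (p q : Pt) : cc a b p q = cc a b q p := by unfold cc; ring
lemma dd_comm (p q : Pt) : dd p q = dd q p := by unfold dd; ring

lemma cc_ne {a b : ℝ} (ha : 0 < a) (hb : 0 < b) {p q : Pt} (hp : onEllipse a b p)
    (hq : onEllipse a b q) (h : p ≠ q) : 0 < 1 - cc a b p q := by
  have h1 := ell a b p hp
  have h2 := ell a b q hq
  have e : 2 * (1 - cc a b p q) = (p.1 / a - q.1 / a) ^ 2 + (p.2 / b - q.2 / b) ^ 2 := by
    unfold cc; linear_combination -h1 - h2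
  by_contra hc
  apply h
  have g1 : (p.1 / a - q.1 / a) ^ 2 = 0 := by
    nlinarith [sq_nonneg (p.1 / a - q.1 / a), sq_nonneg (p.2 / b - q.2 / b)]
  have g2 : (p.2 / b - q.2 / b) ^ 2 = 0 := by
    nlinarith [sq_nonneg (p.1 / a - q.1 / a), sq_nonneg (p.2 / b - q.2 / b)]
  have g1' := sub_eq_zero.1 (pow_eq_zero_iff two_ne_zero |>.1 g1)
  have g2' := sub_eq_zero.1 (pow_eq_zero_iff two_ne_zero |>.1 g2)
  exact Prod.ext ((div_left_inj' ha.ne').1 g1') ((div_left_inj' hb.ne').1 g2')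

/-- the conjugacy equation -/
lemma conj_eq {a b k : ℝ} (ha : 0 < a) (hb : 0 < b) {p q : Pt} (hp : onEllipse a b p)
    (hq : onEllipse a b q) (h : p ≠ q) (hk : (1 - cc a b p q) ^ 2 = k * dd p q) :
    (1 - k * (a ^ 2 - b ^ 2)) * ((p.1 / a) * (q.1 / a))
      + (1 + k * (a ^ 2 - b ^ 2)) * ((p.2 / b) * (q.2 / b)) = 1 - k * (a ^ 2 + b ^ 2) := by
  have h1 := ell a b p hp
  have h2 := ell a b q hq
  have hc := cc_ne ha hb hp hq h
  unfold dd at hk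
  unfold cc at hk hc
  have e1 : p.1 = a * (p.1 / a) := by field_simp
  have e2 : p.2 = b * (p.2 / b) := by field_simp
  have e3 : q.1 = a * (q.1 / a) := by field_simp
  have e4 : q.2 = b * (q.2 / b) := by field_simp
  generalize p.1 / a = x at *
  generalize p.2 / b = y at *
  generalize q.1 / a = z at *
  generalize q.2 / b = w at *
  rw [e1, e2, e3, e4] at hk
  -- (x-z)^2 = (1-c)(1 - (xz - yw)), (y-w)^2 = (1-c)(1 + xz - yw)
  have f1 : (x - z) ^ 2 = (1 - (x * z + y * w)) * (1 - (x * z - y * w)) := by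
    linear_combination y ^ 2 * h2 + (1 - z ^ 2) * h1
  have f2 : (y - w) ^ 2 = (1 - (x * z + y * w)) * (1 + (x * z - y * w)) := by
    linear_combination x ^ 2 * h2 + (1 - w ^ 2) * h1
  apply mul_left_cancel₀ hc.ne'
  linear_combination -hk - k * a ^ 2 * f1 - k * b ^ 2 * f2

/-- tangency -/
lemma tang {a b k L M : ℝ} (ha : 0 < a) (hb : 0 < b) {p q : Pt} (hp : onEllipse a b p)
    (hq : onEllipse a b q) (h : p ≠ q) (hk : (1 - cc a b p q) ^ 2 = k * dd p q)
    (hL : L ≠ 0) (hM : M ≠ 0) (hL2 : L ^ 2 = a ^ 2 - a ^ 2 * b ^ 2 * k)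
    (hM2 : M ^ 2 = b ^ 2 - a ^ 2 * b ^ 2 * k) :
    ∃ s : ℝ, (p.1 + s * (q.1 - p.1)) ^ 2 / L ^ 2 + (p.2 + s * (q.2 - p.2)) ^ 2 / M ^ 2 = 1 ∧
      (p.1 + s * (q.1 - p.1)) * (q.1 - p.1) / L ^ 2
        + (p.2 + s * (q.2 - p.2)) * (q.2 - p.2) / M ^ 2 = 0 := by
  have hd := dd_pos h
  have T : L ^ 2 * (q.2 - p.2) ^ 2 + M ^ 2 * (q.1 - p.1) ^ 2
      = (p.1 * (q.2 - p.2) - p.2 * (q.1 - p.1)) ^ 2 := by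
    have h1 := ell a b p hp
    have h2 := ell a b q hq
    unfold dd at hk
    unfold cc at hk
    have e1 : p.1 = a * (p.1 / a) := by field_simp
    have e2 : p.2 = b * (p.2 / b) := by field_simp
    have e3 : q.1 = a * (q.1 / a) := by field_simp
    have e4 : q.2 = b * (q.2 / b) := by field_simp
    generalize p.1 / a = x at *
    generalize p.2 / b = y at *
    generalize q.1 / a = z at *
    generalize q.2 / b = w at *
    rw [hL2, hM2]
    rw [e1, e2, e3, e4] at hk ⊢
    linear_combination (a ^ 2 * b ^ 2) * hk + (a ^ 2 * b ^ 2) * (h1 + h2)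
      - a ^ 2 * b ^ 2 * (h1 * (z ^ 2 + w ^ 2) + h2)
  generalize hu : q.1 - p.1 = u at *
  generalize hv : q.2 - p.2 = v at *
  have hW : 0 < L ^ 2 * v ^ 2 + M ^ 2 * u ^ 2 := by
    have hd' : 0 < u ^ 2 + v ^ 2 := by
      unfold dd at hd; rw [← hu, ← hv]; linarith
    have hL' : 0 < L ^ 2 := by positivity
    have hM' : 0 < M ^ 2 := by positivity
    rcases eq_or_ne u 0 with h0 | h0
    · have : 0 < v ^ 2 := by rw [h0] at hd'; linarith
      positivity
    · positivity
  generalize p.1 = x at *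
  generalize p.2 = y at *
  have hW' := hW.ne'
  set W := L ^ 2 * v ^ 2 + M ^ 2 * u ^ 2 with hWd
  have m1 : x + -(M ^ 2 * x * u + L ^ 2 * y * v) / W * u = L ^ 2 * v * (x * v - y * u) / W := by
    rw [eq_div_iff hW', add_mul, mul_assoc, mul_comm u W, ← mul_assoc, div_mul_cancel₀ _ hW', hWd]
    ring
  have m2 : y + -(M ^ 2 * x * u + L ^ 2 * y * v) / W * v = -(M ^ 2 * u * (x * v - y * u)) / W := by
    rw [eq_div_iff hW', add_mul, mul_assoc, mul_comm v W, ← mul_assoc, div_mul_cancel₀ _ hW', hWd]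
    ring
  refine ⟨-(M ^ 2 * x * u + L ^ 2 * y * v) / W, ?_, ?_⟩
  · rw [m1, m2]
    have : (L ^ 2 * v * (x * v - y * u) / W) ^ 2 / L ^ 2
        + (-(M ^ 2 * u * (x * v - y * u)) / W) ^ 2 / M ^ 2
        = (L ^ 2 * v ^ 2 + M ^ 2 * u ^ 2) * (x * v - y * u) ^ 2 / W ^ 2 := by
      field_simp
    rw [this, ← T, ← hWd]
    field_simp
  · rw [m1, m2]
    field_simp
    ring

end CausticAux

open CausticAux in
/-- every side of every 3-periodic billiard orbit is tangent to the
confocal caustic ellipse with semi-axes a'' = a(δ − b²)/(a² − b²) and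
b'' = b(a² − δ)/(a² − b²); moreover a''² − b''² = c². -/
theorem confocal_caustic_three_periodics (a b : ℝ) (hab : a > b) (hb : b > 0)
    (T : Orbit3 a b) :
    let δ : ℝ := Real.sqrt (a ^ 4 - a ^ 2 * b ^ 2 + b ^ 4)
    let a'' : ℝ := a * (δ - b ^ 2) / (a ^ 2 - b ^ 2)
    let b'' : ℝ := b * (a ^ 2 - δ) / (a ^ 2 - b ^ 2)
    a'' ^ 2 - b'' ^ 2 = a ^ 2 - b ^ 2 ∧
    ∀ P Q : Pt,
      (P, Q) = (T.P1, T.P2) ∨ (P, Q) = (T.P2, T.P3) ∨ (P, Q) = (T.P3, T.P1) →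
      ∃ s : ℝ,
        let M : Pt := P + s • (Q - P)
        M.1 ^ 2 / a'' ^ 2 + M.2 ^ 2 / b'' ^ 2 = 1 ∧
        M.1 * (Q.1 - P.1) / a'' ^ 2 + M.2 * (Q.2 - P.2) / b'' ^ 2 = 0 := by
  intro δ a'' b''
  have ha : 0 < a := hb.trans hab
  have hD : 0 < a ^ 2 - b ^ 2 := by nlinarith
  have hδ2 : δ ^ 2 = a ^ 4 - a ^ 2 * b ^ 2 + b ^ 4 :=
    Real.sq_sqrt (by nlinarith [sq_nonneg (a ^ 2 - b ^ 2), mul_pos (pow_pos ha 2) (pow_pos hb 2)])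
  have hδ0 : 0 ≤ δ := Real.sqrt_nonneg _
  have ha2 : 0 < a ^ 2 := by positivity
  have hb2 : 0 < b ^ 2 := by positivity
  have hδb : b ^ 2 < δ := by
    apply lt_of_pow_lt_pow_left₀ 2 hδ0
    nlinarith [mul_pos ha2 hD]
  have hδa : δ < a ^ 2 := by
    apply lt_of_pow_lt_pow_left₀ 2 ha2.le
    nlinarith [mul_pos hb2 hD]
  have hL : a'' ≠ 0 := by
    have : 0 < a'' := div_pos (mul_pos ha (by linarith)) hD
    exact this.ne'
  have hM : b'' ≠ 0 := by
    have : 0 < b'' := div_pos (mul_pos hb (by linarith)) hD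
    exact this.ne'
  obtain ⟨P1, P2, P3, h1, h2, h3, d12, d23, d31, r1, r2, r3⟩ := T
  obtain ⟨k, hkdef⟩ : ∃ k, k = (1 - cc a b P1 P2) ^ 2 / dd P1 P2 := ⟨_, rfl⟩
  have R1 := refl_aux a b P3 P1 P2 h1 r1
  have R2 := refl_aux a b P1 P2 P3 h2 r2
  have hk12 : (1 - cc a b P1 P2) ^ 2 = k * dd P1 P2 := by
    rw [hkdef, div_mul_cancel₀ _ (dd_pos d12).ne']
  have hk13 : (1 - cc a b P1 P3) ^ 2 = k * dd P1 P3 := by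
    rw [hkdef, ← R1, div_mul_cancel₀ _ (dd_pos d31.symm).ne']
  have hk23 : (1 - cc a b P2 P3) ^ 2 = k * dd P2 P3 := by
    rw [hkdef, cc_comm a b P1, dd_comm P1, R2, div_mul_cancel₀ _ (dd_pos d23).ne']
  have hk31 : (1 - cc a b P3 P1) ^ 2 = k * dd P3 P1 := by
    rw [cc_comm a b P3, dd_comm P3, hk13]
  have hk : 0 < k := by
    rw [hkdef]; exact div_pos (pow_pos (cc_ne ha hb h1 h2 d12) 2) (dd_pos d12)
  have hkD : 0 < k * (a ^ 2 - b ^ 2) := mul_pos hk hD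
  have ne : ∀ {p q : Pt}, p ≠ q → ¬ (p.1 / a = q.1 / a ∧ p.2 / b = q.2 / b) := by
    intro p q h hh
    exact h (Prod.ext ((div_left_inj' ha.ne').1 hh.1) ((div_left_inj' hb.ne').1 hh.2))
  have quad := core _ _ _ _ _ _ _ _ _ (ell a b P1 h1) (ell a b P2 h2) (ell a b P3 h3)
    (conj_eq ha hb h1 h2 d12 hk12) (conj_eq ha hb h1 h3 d31.symm hk13)
    (conj_eq ha hb h2 h3 d23 hk23) (ne d12) (ne d31.symm) (ne d23) (by linarith) (by linarith)
  have hkval : k * (a ^ 2 - b ^ 2) ^ 2 = 2 * δ - (a ^ 2 + b ^ 2) := by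
    have e : (k * (a ^ 2 - b ^ 2) ^ 2 + (a ^ 2 + b ^ 2)) ^ 2 = (2 * δ) ^ 2 := by
      linear_combination -(a ^ 2 - b ^ 2) ^ 2 * quad - 4 * hδ2
    have := (pow_left_inj₀ (by positivity) (by positivity) two_ne_zero).1 e
    linarith
  have hL2 : a'' ^ 2 = a ^ 2 - a ^ 2 * b ^ 2 * k := by
    simp only [a'']
    rw [div_pow, div_eq_iff (by positivity)]
    linear_combination a ^ 2 * hδ2 + a ^ 2 * b ^ 2 * hkval
  have hM2 : b'' ^ 2 = b ^ 2 - a ^ 2 * b ^ 2 * k := by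
    simp only [b'']
    rw [div_pow, div_eq_iff (by positivity)]
    linear_combination b ^ 2 * hδ2 + a ^ 2 * b ^ 2 * hkval
  refine ⟨by linarith, ?_⟩
  intro P Q hPQ
  have fin : onEllipse a b P ∧ onEllipse a b Q ∧ P ≠ Q ∧
      (1 - cc a b P Q) ^ 2 = k * dd P Q := by
    rcases hPQ with h | h | h <;> obtain ⟨rfl, rfl⟩ := Prod.mk.inj h
    · exact ⟨h1, h2, d12, hk12⟩
    · exact ⟨h2, h3, d23, hk23⟩
    · exact ⟨h3, h1, d31, hk31⟩
  obtain ⟨f1, f2, f3, f4⟩ := fin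
  obtain ⟨s, t1, t2⟩ := tang ha hb f1 f2 f3 f4 hL hM hL2 hM2
  exact ⟨s, t1, t2⟩
end
end

section
/- Over the family of 3-periodic billiard orbits in the ellipse x²/a² + y²/b² = 1, the perimeter of the focus-inversive triangle is invariant and equals L† = ρ² √((8a⁴ + 4a²b² + 2b⁴)δ + 8a⁶ + 3a²b⁴ + 2b⁶)/(a²b²), where δ = √(a⁴ − a²b² + b⁴). -/
noncomputable section

open BilliardInv Real

namespace FIP

lemma det_sq (X1 Y1 X2 Y2 X3 Y3 : ℝ) (h1 : X1^2+Y1^2=1) (h2 : X2^2+Y2^2=1)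
    (h3 : X3^2+Y3^2=1) :
    (X1*(Y2-Y3)+Y1*(X3-X2)+(X2*Y3-X3*Y2))^2
      = 2*(1-X1*X2-Y1*Y2)*(1-X2*X3-Y2*Y3)*(1-X3*X1-Y3*Y1) := by
  have e1 : Y1^2 = 1 - X1^2 := by linarith
  have e2 : Y2^2 = 1 - X2^2 := by linarith
  have e3 : Y3^2 = 1 - X3^2 := by linarith
  grind

lemma solve (X1 Y1 X2 Y2 X3 Y3 u v w : ℝ)
    (hd : X1*(Y2-Y3)+Y1*(X3-X2)+(X2*Y3-X3*Y2) ≠ 0)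
    (h1 : u*X1+v*Y1+w=0) (h2 : u*X2+v*Y2+w=0) (h3 : u*X3+v*Y3+w=0) :
    u = 0 ∧ v = 0 ∧ w = 0 := by
  refine ⟨?_, ?_, ?_⟩
  · apply (mul_eq_zero.mp (?_ : (X1*(Y2-Y3)+Y1*(X3-X2)+(X2*Y3-X3*Y2)) * u = 0)).resolve_left hd
    linear_combination (Y2-Y3)*h1+(Y3-Y1)*h2+(Y1-Y2)*h3
  · apply (mul_eq_zero.mp (?_ : (X1*(Y2-Y3)+Y1*(X3-X2)+(X2*Y3-X3*Y2)) * v = 0)).resolve_left hd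
    linear_combination (X3-X2)*h1+(X1-X3)*h2+(X2-X1)*h3
  · apply (mul_eq_zero.mp (?_ : (X1*(Y2-Y3)+Y1*(X3-X2)+(X2*Y3-X3*Y2)) * w = 0)).resolve_left hd
    linear_combination (X2*Y3-X3*Y2)*h1+(X3*Y1-X1*Y3)*h2+(X1*Y2-X2*Y1)*h3

/-- Resolution of the diagonal form in a self-polar basis. -/
lemma resol (α β γ X1 Y1 X2 Y2 X3 Y3 w1 w2 w3 f1 f2 f3 g1 g2 g3 : ℝ)
    (hd : X1*(Y2-Y3)+Y1*(X3-X2)+(X2*Y3-X3*Y2) ≠ 0)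
    (h12 : α*X1*X2+β*Y1*Y2=γ) (h23 : α*X2*X3+β*Y2*Y3=γ) (h31 : α*X3*X1+β*Y3*Y1=γ)
    (hw1 : w1*(α*X1^2+β*Y1^2-γ)=1) (hw2 : w2*(α*X2^2+β*Y2^2-γ)=1)
    (hw3 : w3*(α*X3^2+β*Y3^2-γ)=1)
    (hf1 : f1 = g1*X1+g2*Y1+g3) (hf2 : f2 = g1*X2+g2*Y2+g3) (hf3 : f3 = g1*X3+g2*Y3+g3) :
    α*(w1*f1*X1+w2*f2*X2+w3*f3*X3) - g1 = 0 ∧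
    β*(w1*f1*Y1+w2*f2*Y2+w3*f3*Y3) - g2 = 0 ∧
    -γ*(w1*f1+w2*f2+w3*f3) - g3 = 0 := by
  apply solve X1 Y1 X2 Y2 X3 Y3 _ _ _ hd
  · linear_combination f1*hw1 + w2*f2*h12 + w3*f3*h31 + hf1
  · linear_combination f2*hw2 + w1*f1*h12 + w3*f3*h23 + hf2
  · linear_combination f3*hw3 + w1*f1*h31 + w2*f2*h23 + hf3

lemma diag_ne (α β γ X1 Y1 X2 Y2 X3 Y3 : ℝ)
    (hd : X1*(Y2-Y3)+Y1*(X3-X2)+(X2*Y3-X3*Y2) ≠ 0)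
    (hβ : β ≠ 0) (hαγ : α ≠ 0 ∨ γ ≠ 0) (c1 : X1^2+Y1^2=1)
    (h12 : α*X1*X2+β*Y1*Y2=γ) (h31 : α*X3*X1+β*Y3*Y1=γ) :
    α*X1^2+β*Y1^2-γ ≠ 0 := by
  intro h
  obtain ⟨h1, h2, h3⟩ := solve X1 Y1 X2 Y2 X3 Y3 (α*X1) (β*Y1) (-γ) hd
    (by linear_combination h) (by linear_combination h12) (by linear_combination h31)
  have hY : Y1 = 0 := (mul_eq_zero.mp h2).resolve_left hβ
  rcases hαγ with hα | hγ
  · have hX : X1 = 0 := (mul_eq_zero.mp h1).resolve_left hα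
    rw [hX, hY] at c1; norm_num at c1
  · exact hγ (by linarith)

lemma rel (a b k J s X1 Y1 X2 Y2 : ℝ) (hk : k^2 = a^2-b^2)
    (c1 : X1^2+Y1^2=1) (c2 : X2^2+Y2^2=1)
    (hs : s^2 = a^2*(X1-X2)^2+b^2*(Y1-Y2)^2) (hJ : J*s = 1-X1*X2-Y1*Y2)
    (hp : 0 < 1-X1*X2-Y1*Y2) :
    (1-J^2*k^2)*X1*X2+(1+J^2*k^2)*Y1*Y2 = 1-J^2*(a^2+b^2) := by
  have e : s^2 = (1-X1*X2-Y1*Y2)*(a^2+b^2-k^2*(X1*X2-Y1*Y2)) := by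
    rw [hs, hk]
    have e1 : Y1^2 = 1 - X1^2 := by linarith
    have e2 : Y2^2 = 1 - X2^2 := by linarith
    grind
  have e2 : (1-X1*X2-Y1*Y2) * ((1-X1*X2-Y1*Y2) - J^2*(a^2+b^2-k^2*(X1*X2-Y1*Y2))) = 0 := by
    rw [mul_sub, ← sq, ← hJ]
    rw [← hJ] at e
    linear_combination J^2*e
  have := (mul_eq_zero.mp e2).resolve_left hp.ne'
  linear_combination -this

lemma core (a b k J s12 s23 s31 X1 Y1 X2 Y2 X3 Y3 : ℝ) (hb : 0 < b) (hab : b < a) (hk0 : 0 ≤ k)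
    (hk : k^2 = a^2-b^2)
    (c1 : X1^2+Y1^2=1) (c2 : X2^2+Y2^2=1) (c3 : X3^2+Y3^2=1)
    (p12 : 0 < 1-X1*X2-Y1*Y2) (p23 : 0 < 1-X2*X3-Y2*Y3) (p31 : 0 < 1-X3*X1-Y3*Y1)
    (hs12 : s12^2 = a^2*(X1-X2)^2+b^2*(Y1-Y2)^2)
    (hs23 : s23^2 = a^2*(X2-X3)^2+b^2*(Y2-Y3)^2)
    (hs31 : s31^2 = a^2*(X3-X1)^2+b^2*(Y3-Y1)^2)
    (hJ12 : J*s12 = 1-X1*X2-Y1*Y2) (hJ23 : J*s23 = 1-X2*X3-Y2*Y3)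
    (hJ31 : J*s31 = 1-X3*X1-Y3*Y1)
    (r1 : 0 < a+k*X1) (r2 : 0 < a+k*X2) (r3 : 0 < a+k*X3)  :
    1-J^2*(a^2+b^2) ≠ 0 ∧ J^4*k^4+2*J^2*(a^2+b^2) = 3 ∧
    s12/((a+k*X1)*(a+k*X2))+s23/((a+k*X2)*(a+k*X3))+s31/((a+k*X3)*(a+k*X1))
      = 2*J/(1+J^2*k^2)*(-4*a^2*J^2/(1-J^2*(a^2+b^2))-3) := by
  have hJ0 : J ≠ 0 := by
    rintro rfl; linarith
  have hJ2 : 0 < J^2 := by positivity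
  have h12 := rel a b k J s12 X1 Y1 X2 Y2 hk c1 c2 hs12 hJ12 p12
  have h23 := rel a b k J s23 X2 Y2 X3 Y3 hk c2 c3 hs23 hJ23 p23
  have h31 := rel a b k J s31 X3 Y3 X1 Y1 hk c3 c1 hs31 hJ31 p31
  have hd : X1*(Y2-Y3)+Y1*(X3-X2)+(X2*Y3-X3*Y2) ≠ 0 := by
    intro h
    have := det_sq X1 Y1 X2 Y2 X3 Y3 c1 c2 c3
    rw [h] at this
    have : 0 < 2*(1-X1*X2-Y1*Y2)*(1-X2*X3-Y2*Y3)*(1-X3*X1-Y3*Y1) := by positivity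
    linarith
  have hβ : 0 < 1+J^2*k^2 := by positivity
  have hαγ : (1-J^2*k^2) ≠ 0 ∨ 1-J^2*(a^2+b^2) ≠ 0 := by
    by_contra! h
    obtain ⟨h1, h2⟩ := h
    rw [hk] at h1
    have : 0 < J^2*b^2 := by positivity
    nlinarith
  have hd2 : X2*(Y3-Y1)+Y2*(X1-X3)+(X3*Y1-X1*Y3) ≠ 0 := by
    intro h; apply hd; linear_combination h
  have hd3 : X3*(Y1-Y2)+Y3*(X2-X1)+(X1*Y2-X2*Y1) ≠ 0 := by
    intro h; apply hd; linear_combination h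
  have n1 := diag_ne _ _ _ X1 Y1 X2 Y2 X3 Y3 hd hβ.ne' hαγ c1 h12 h31
  have n2 := diag_ne _ _ _ X2 Y2 X3 Y3 X1 Y1 hd2 hβ.ne' hαγ c2 h23 h12
  have n3 := diag_ne _ _ _ X3 Y3 X1 Y1 X2 Y2 hd3 hβ.ne' hαγ c3 h31 h23
  obtain ⟨w1, hw1⟩ : ∃ w, w*((1-J^2*k^2)*X1^2+(1+J^2*k^2)*Y1^2-(1-J^2*(a^2+b^2))) = 1 :=
    ⟨_, inv_mul_cancel₀ n1⟩
  obtain ⟨w2, hw2⟩ : ∃ w, w*((1-J^2*k^2)*X2^2+(1+J^2*k^2)*Y2^2-(1-J^2*(a^2+b^2))) = 1 :=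
    ⟨_, inv_mul_cancel₀ n2⟩
  obtain ⟨w3, hw3⟩ : ∃ w, w*((1-J^2*k^2)*X3^2+(1+J^2*k^2)*Y3^2-(1-J^2*(a^2+b^2))) = 1 :=
    ⟨_, inv_mul_cancel₀ n3⟩
  have hA := resol _ _ _ X1 Y1 X2 Y2 X3 Y3 w1 w2 w3 1 1 1 0 0 1 hd h12 h23 h31 hw1 hw2 hw3
    (by ring) (by ring) (by ring)
  have hB := resol _ _ _ X1 Y1 X2 Y2 X3 Y3 w1 w2 w3 X1 X2 X3 1 0 0 hd h12 h23 h31 hw1 hw2 hw3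
    (by ring) (by ring) (by ring)
  have hC := resol _ _ _ X1 Y1 X2 Y2 X3 Y3 w1 w2 w3 Y1 Y2 Y3 0 1 0 hd h12 h23 h31 hw1 hw2 hw3
    (by ring) (by ring) (by ring)
  have A1 := hA.1
  have A3 := hA.2.2
  have B1 := hB.1
  have C2 := hC.2.1
  have hα : (1-J^2*k^2) ≠ 0 := by
    intro h; rw [h] at B1; norm_num at B1
  have hγ : 1-J^2*(a^2+b^2) ≠ 0 := by
    intro h; rw [h] at A3; norm_num at A3
  have S1 : w1*X1+w2*X2+w3*X3 = 0 := by
    apply (mul_eq_zero.mp (?_ : (1-J^2*k^2)*(w1*X1+w2*X2+w3*X3) = 0)).resolve_left hα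
    linear_combination A1
  have ap : J^4*k^4+2*J^2*(a^2+b^2) = 3 := by
    generalize ha' : a^2+b^2 = m at *
    have e : (w1*X1*X1+w2*X2*X2+w3*X3*X3) + (w1*Y1*Y1+w2*Y2*Y2+w3*Y3*Y3) = w1+w2+w3 := by
      linear_combination w1*c1+w2*c2+w3*c3
    linear_combination -((1-J^2*k^2)*(1+J^2*k^2)*(1-J^2*m))*e
      + ((1+J^2*k^2)*(1-J^2*m))*B1 + ((1-J^2*k^2)*(1-J^2*m))*C2 + (1-J^2*k^2)*(1+J^2*k^2)*A3
  have inv : ∀ X Y w, X^2+Y^2=1 → 0 < a+k*X →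
      w*((1-J^2*k^2)*X^2+(1+J^2*k^2)*Y^2-(1-J^2*(a^2+b^2))) = 1 →
      1/(a+k*X) = 2*J^2*(a-k*X)*w := by
    intro X Y w c r hw
    rw [div_eq_iff r.ne', ← hw]
    have : Y^2 = 1 - X^2 := by linarith
    rw [this]
    linear_combination w*J^2*hk
  have i1 := inv X1 Y1 w1 c1 r1 hw1
  have i2 := inv X2 Y2 w2 c2 r2 hw2
  have i3 := inv X3 Y3 w3 c3 r3 hw3
  have side : ∀ s X Y X' Y', J*s = 1-X*X'-Y*Y' → 0 < a+k*X → 0 < a+k*X' →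
      (1-J^2*k^2)*X*X'+(1+J^2*k^2)*Y*Y' = 1-J^2*(a^2+b^2) →
      s/((a+k*X)*(a+k*X')) = 2*J/(1+J^2*k^2)*(a*(1/(a+k*X)+1/(a+k*X'))-1) := by
    intro s X Y X' Y' h r r' hh
    have r0 := r.ne'
    have r0' := r'.ne'
    have e : (1+J^2*k^2)*s = 2*J*(a^2-k^2*X*X') := by
      apply mul_left_cancel₀ hJ0
      linear_combination (1+J^2*k^2)*h - hh + J^2*hk
    field_simp
    linear_combination e
  rw [side _ _ _ _ _ hJ12 r1 r2 h12, side _ _ _ _ _ hJ23 r2 r3 h23, side _ _ _ _ _ hJ31 r3 r1 h31]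
  refine ⟨hγ, ap, ?_⟩
  have tot : 1/(a+k*X1)+1/(a+k*X2)+1/(a+k*X3) = -2*a*J^2/(1-J^2*(a^2+b^2)) := by
    rw [i1, i2, i3, eq_div_iff hγ]
    linear_combination -2*J^2*a*A3 - 2*J^2*k*(1-J^2*(a^2+b^2))*S1
  have : -4*a^2*J^2/(1-J^2*(a^2+b^2)) = 2*a*(-2*a*J^2/(1-J^2*(a^2+b^2))) := by ring
  rw [this, ← tot]
  ring

/-- Final evaluation in terms of `δ`. -/
lemma final_sq (a b k J δ : ℝ) (hb : 0 < b) (hab : b < a) (hk : k^2 = a^2-b^2)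
    (hδ : δ^2 = a^4-a^2*b^2+b^4) (hδ0 : 0 ≤ δ) (hγ : 1-J^2*(a^2+b^2) ≠ 0)
    (ap : J^4*k^4+2*J^2*(a^2+b^2) = 3) :
    (2*J/(1+J^2*k^2)*(-4*a^2*J^2/(1-J^2*(a^2+b^2))-3))^2 =
      ((8 * a ^ 4 + 4 * a ^ 2 * b ^ 2 + 2 * b ^ 4) * δ +
        8 * a ^ 6 + 3 * a ^ 2 * b ^ 4 + 2 * b ^ 6) / (a^2*b^2)^2 := by
  have ha : 0 < a := by linarith
  have hJ0 : 0 ≤ J^2 := by positivity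
  have hk4 : k^4 = (a^2-b^2)^2 := by rw [← hk]; ring
  have hkp : 0 < a^2-b^2 := by nlinarith
  have e1 : J^2*k^4+(a^2+b^2) = 2*δ := by
    apply (pow_left_inj₀ (by positivity) (by positivity) two_ne_zero).mp
    have ap' := ap
    rw [hk4] at ap' ⊢
    linear_combination (a^2-b^2)^2*ap' - 4*hδ
  have hs : 0 < 2*δ+a^2+b^2 := by positivity
  have hj : J^2 = 3/(2*δ+a^2+b^2) := by
    rw [eq_div_iff hs.ne']
    linear_combination ap - J^2*e1
  have hβ : 0 < δ+2*a^2-b^2 := by nlinarith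
  have g : 1-J^2*(a^2+b^2) = 2*(δ-(a^2+b^2))/(2*δ+a^2+b^2) := by
    rw [hj]; field_simp; ring
  have hg : δ-(a^2+b^2) ≠ 0 := by
    intro h; apply hγ; rw [g, h]; simp
  have bt : 1+J^2*k^2 = 2*(δ+2*a^2-b^2)/(2*δ+a^2+b^2) := by
    rw [hj, hk]; field_simp; ring
  have l : (2*J/(1+J^2*k^2)*(-4*a^2*J^2/(1-J^2*(a^2+b^2))-3))^2 =
    27*(2*δ+a^2+b^2)*(a^2-b^2+δ)^2/((δ-(a^2+b^2))^2*(δ+2*a^2-b^2)^2) := by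
    have : (2*J/(1+J^2*k^2)*(-4*a^2*J^2/(1-J^2*(a^2+b^2))-3))^2 =
      4*J^2/(1+J^2*k^2)^2*(-4*a^2*J^2/(1-J^2*(a^2+b^2))-3)^2 := by
      rw [mul_pow, div_pow]; ring
    rw [this, bt, g, hj]
    field_simp
    ring
  rw [l, div_eq_div_iff (by positivity) (by positivity)]
  have q : δ^2 = a^4-a^2*b^2+b^4 := hδ
  clear l g bt hj e1 ap hγ
  grind

lemma dst_comm (p q : Pt) : dst p q = dst q p := by
  unfold dst; congr 1; ring

lemma dst_sq (p q : Pt) : dst p q ^ 2 = (p.1-q.1)^2+(p.2-q.2)^2 :=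
  Real.sq_sqrt (by positivity)

lemma dst_pos {p q : Pt} (h : p ≠ q) : 0 < dst p q := by
  apply Real.sqrt_pos.mpr
  by_contra! h'
  apply h
  have h1 : p.1 - q.1 = 0 := by nlinarith [sq_nonneg (p.1-q.1), sq_nonneg (p.2-q.2)]
  have h2 : p.2 - q.2 = 0 := by nlinarith [sq_nonneg (p.1-q.1), sq_nonneg (p.2-q.2)]
  exact Prod.ext (by linarith) (by linarith)

lemma dot_udir (a b : ℝ) (v q : Pt) (hv : onEllipse a b v) :
    dot (udir v q) (nrm a b v) =
      -((1 - v.1/a*(q.1/a) - v.2/b*(q.2/b)) / dst v q) := by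
  unfold onEllipse at hv
  simp only [dot, udir, nrm, Prod.smul_fst, Prod.smul_snd, Prod.fst_sub, Prod.snd_sub, smul_eq_mul]
  linear_combination -(dst v q)⁻¹*hv

lemma circ (a b : ℝ) (p : Pt) (h : onEllipse a b p) : (p.1/a)^2+(p.2/b)^2=1 := by
  unfold onEllipse at h; rw [div_pow, div_pow]; exact h

lemma inva_dst (ρ : ℝ) (f p q : Pt) (r s : ℝ) (hr : 0 < r) (hs : 0 < s)
    (h1 : (p.1-f.1)^2+(p.2-f.2)^2 = r^2) (h2 : (q.1-f.1)^2+(q.2-f.2)^2 = s^2) :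
    dst (inva ρ f p) (inva ρ f q) = ρ^2*(dst p q/(r*s)) := by
  have : 0 ≤ dst p q := Real.sqrt_nonneg _
  apply (pow_left_inj₀ (Real.sqrt_nonneg _) (by positivity) two_ne_zero).mp
  rw [mul_pow, div_pow, dst_sq p q]
  rw [← dst, dst_sq]
  simp only [inva, Prod.smul_fst, Prod.smul_snd, Prod.fst_sub, Prod.snd_sub, smul_eq_mul,
    Prod.fst_add, Prod.snd_add]
  rw [h1, h2]
  have e : (p.1-q.1)^2+(p.2-q.2)^2 = r^2+s^2-2*((p.1-f.1)*(q.1-f.1)+(p.2-f.2)*(q.2-f.2)) := by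
    linear_combination h1+h2
  rw [e]
  field_simp
  linear_combination ρ^4*s^4*h1+ρ^4*r^4*h2

lemma focal (a b k : ℝ) (p : Pt) (ha : 0 < a) (hb : 0 < b) (hk : k^2=a^2-b^2)
    (h : (p.1/a)^2+(p.2/b)^2=1) :
    (p.1-(-k))^2+(p.2-0)^2 = (a+k*(p.1/a))^2 := by
  have h1 : p.1 = a*(p.1/a) := by field_simp
  have h2 : p.2 = b*(p.2/b) := by field_simp
  generalize p.1/a = X at *
  generalize p.2/b = Y at *
  rw [h1, h2]
  linear_combination b^2*h + (1-X^2)*hk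

lemma focal_pos (a b k X Y : ℝ) (hb : 0 < b) (hab : b < a) (hk0 : 0 ≤ k) (hk : k^2=a^2-b^2)
    (h : X^2+Y^2=1) : 0 < a+k*X := by
  have hX : -1 ≤ X := by nlinarith [sq_nonneg Y]
  have : k < a := by nlinarith
  nlinarith

lemma pos_one_sub (a b : ℝ) (p q : Pt) (ha : 0 < a) (hb : 0 < b) (hpq : p ≠ q)
    (h1 : (p.1/a)^2+(p.2/b)^2=1) (h2 : (q.1/a)^2+(q.2/b)^2=1) :
    0 < 1 - p.1/a*(q.1/a) - p.2/b*(q.2/b) := by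
  by_contra! h
  have e1 : p.1/a - q.1/a = 0 := by
    nlinarith [sq_nonneg (p.1/a - q.1/a), sq_nonneg (p.2/b-q.2/b)]
  have e2 : p.2/b - q.2/b = 0 := by
    nlinarith [sq_nonneg (p.1/a - q.1/a), sq_nonneg (p.2/b-q.2/b)]
  apply hpq
  rw [← sub_div, div_eq_zero_iff] at e1 e2
  have e1 := e1.resolve_right ha.ne'
  have e2 := e2.resolve_right hb.ne'
  exact Prod.ext (by linarith) (by linarith)

lemma side_sq (a b : ℝ) (p q : Pt) (ha : 0 < a) (hb : 0 < b) :
    dst p q ^ 2 = a^2*(p.1/a-q.1/a)^2+b^2*(p.2/b-q.2/b)^2 := by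
  rw [dst_sq]; field_simp

end FIP

/-- the perimeter of the focus-inversive triangle is invariant over
the 3-periodic billiard family and equals
ρ²√((8a⁴+4a²b²+2b⁴)δ + 8a⁶+3a²b⁴+2b⁶)/(a²b²). -/
theorem focus_inversive_perimeter (a b ρ : ℝ) (hab : a > b) (hb : b > 0) (hρ : ρ > 0)
    (T : Orbit3 a b) :
    let δ : ℝ := Real.sqrt (a ^ 4 - a ^ 2 * b ^ 2 + b ^ 4)
    let f1 : Pt := (-Real.sqrt (a ^ 2 - b ^ 2), 0)
    let Q1 := inva ρ f1 T.P1
    let Q2 := inva ρ f1 T.P2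
    let Q3 := inva ρ f1 T.P3
    dst Q1 Q2 + dst Q2 Q3 + dst Q3 Q1 =
      ρ ^ 2 * Real.sqrt ((8 * a ^ 4 + 4 * a ^ 2 * b ^ 2 + 2 * b ^ 4) * δ +
        8 * a ^ 6 + 3 * a ^ 2 * b ^ 4 + 2 * b ^ 6) / (a ^ 2 * b ^ 2) := by
  intro δ f1 Q1 Q2 Q3
  have ha : 0 < a := by linarith
  obtain ⟨P1, P2, P3, h1, h2, h3, d12, d23, d31, r1, r2, r3⟩ := T
  have hδ : δ^2 = a^4-a^2*b^2+b^4 :=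
    Real.sq_sqrt (by nlinarith [sq_nonneg (a^2-b^2), sq_nonneg (a*b)])
  have hδ0 : 0 ≤ δ := Real.sqrt_nonneg _
  obtain ⟨k, hkd⟩ : ∃ k, k = Real.sqrt (a^2-b^2) := ⟨_, rfl⟩
  have hk : k^2 = a^2-b^2 := by rw [hkd]; exact Real.sq_sqrt (by nlinarith)
  have hk0 : 0 ≤ k := by rw [hkd]; exact Real.sqrt_nonneg _
  have hf1 : f1.1 = -k := by simp [f1, hkd]
  have hf2 : f1.2 = 0 := rfl
  have c1 := FIP.circ a b P1 h1
  have c2 := FIP.circ a b P2 h2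
  have c3 := FIP.circ a b P3 h3
  unfold reflectAt at r1 r2 r3
  rw [FIP.dot_udir a b _ _ h1, FIP.dot_udir a b _ _ h1, neg_inj] at r1
  rw [FIP.dot_udir a b _ _ h2, FIP.dot_udir a b _ _ h2, neg_inj] at r2
  have s12 := FIP.dst_pos d12
  have s23 := FIP.dst_pos d23
  have s31 := FIP.dst_pos d31
  rw [FIP.dst_comm P1 P3] at r1
  rw [FIP.dst_comm P2 P1] at r2
  obtain ⟨J, hJ⟩ : ∃ J, J = (1 - P1.1/a*(P2.1/a) - P1.2/b*(P2.2/b)) / dst P1 P2 := ⟨_, rfl⟩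
  have j12 : J * dst P1 P2 = 1 - P1.1/a*(P2.1/a) - P1.2/b*(P2.2/b) := by
    rw [hJ]; field_simp
  have j31 : J * dst P3 P1 = 1 - P3.1/a*(P1.1/a) - P3.2/b*(P1.2/b) := by
    rw [hJ, ← r1, div_mul_cancel₀ _ s31.ne']; ring
  have j23 : J * dst P2 P3 = 1 - P2.1/a*(P3.1/a) - P2.2/b*(P3.2/b) := by
    have : J = (1 - P2.1/a*(P1.1/a) - P2.2/b*(P1.2/b)) / dst P1 P2 := by rw [hJ]; ring
    rw [this, r2, div_mul_cancel₀ _ s23.ne']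
  have q1 := FIP.focal_pos a b k _ _ hb hab hk0 hk c1
  have q2 := FIP.focal_pos a b k _ _ hb hab hk0 hk c2
  have q3 := FIP.focal_pos a b k _ _ hb hab hk0 hk c3
  obtain ⟨hγ, ap, hsum⟩ := FIP.core a b k J _ _ _ _ _ _ _ _ _ hb hab hk0 hk c1 c2 c3
    (FIP.pos_one_sub a b _ _ ha hb d12 c1 c2) (FIP.pos_one_sub a b _ _ ha hb d23 c2 c3)
    (FIP.pos_one_sub a b _ _ ha hb d31 c3 c1)
    (FIP.side_sq a b _ _ ha hb) (FIP.side_sq a b _ _ ha hb) (FIP.side_sq a b _ _ ha hb)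
    j12 j23 j31 q1 q2 q3
  have fin := FIP.final_sq a b k J δ hb hab hk hδ hδ0 hγ ap
  rw [← hsum] at fin
  have F := fun p h => FIP.focal a b k p ha hb hk h
  rw [← hf1, ← hf2] at F
  have t12 := FIP.inva_dst ρ f1 P1 P2 _ _ q1 q2 (F _ c1) (F _ c2)
  have t23 := FIP.inva_dst ρ f1 P2 P3 _ _ q2 q3 (F _ c2) (F _ c3)
  have t31 := FIP.inva_dst ρ f1 P3 P1 _ _ q3 q1 (F _ c3) (F _ c1)
  change dst (inva ρ f1 P1) (inva ρ f1 P2) + dst (inva ρ f1 P2) (inva ρ f1 P3)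
    + dst (inva ρ f1 P3) (inva ρ f1 P1) = _
  rw [t12, t23, t31, ← mul_add, ← mul_add, mul_div_assoc]
  congr 1
  apply (pow_left_inj₀ (by positivity) (by positivity) two_ne_zero).mp
  rw [fin, div_pow, Real.sq_sqrt (by positivity)]
end
end

section
/- Over the 3-periodic billiard family, the Mittenpunkt X₉† of the focus-inversive triangle moves along a circle with center C₉† = (−c(1 + ρ²/(2b²)), 0) and radius R₉† = ρ²(2a² − b² − δ)/(2ab²). -/
noncomputable section

open BilliardInv Real

theorem fim_core_g (x1 x2 x3 s m t : ℝ) (h1 : x1 + x2 + x3 = s)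
    (h2 : x1 * x2 + x2 * x3 + x3 * x1 = -m) (h3 : x1 * x2 * x3 = -(t * s)) :
    (1 - x2 * x3) * ((1 + x2) * (1 - x3 * x1) + (1 + x3) * (1 - x1 * x2)
      - (1 + x1) * (1 - x2 * x3)) * ((1 + x2) * (1 + x3)) =
    (1 - m - m^2 + m^3 + 2*s + 2*s*t + 3*s*m*t - 2*s*m^2 - s*m^2*t + s^2 - 3*s^2*t
      - 3*s^2*t^2 + s^2*m + 4*s^2*m*t - 3*s^3*t - s^3*t^2)
    + (-3 - m - 5*s + 2*s*t - s*m - s*m*t + s*m^2 - s^2 + 7*s^2*t + s^2*t^2 - 2*s^2*m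
      - s^2*m*t + s^3 + 3*s^3*t) * x1
    + (4 + m - m^2 + s - 4*s*t + 2*s*m + s*m*t - s^2 - 3*s^2*t) * x1 ^ 2 := by
  have hM : x2 * x3 = x1 ^ 2 - s * x1 - m := by
    linear_combination h2 - x1 * h1
  have hc : x1 ^ 3 - s * x1 ^ 2 - m * x1 + t * s = 0 := by
    linear_combination h3 - x1 * hM
  have hA : (1 + x2) * (1 + x3) = 1 + (s - x1) + (x1 ^ 2 - s * x1 - m) := by
    linear_combination hM + h1
  have hB : (1 + x2) * (1 - x3 * x1) + (1 + x3) * (1 - x1 * x2) - (1 + x1) * (1 - x2 * x3)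
      = 1 + t * s + s + m - 2 * x1 + 2 * (x1 ^ 2 - s * x1 - m) := by
    linear_combination h1 - h2 - h3 + 2 * hM
  rw [hA, hB, hM]
  linear_combination ((-1) + (-3)*m^1 + (4)*s^1 + (3)*s^1*t^1 + (-3)*s^1*m^1 + (3)*s^2 + (1)*s^2*t^1 + (-3)*x1^1 + (3)*x1^1*m^1 + (-7)*x1^1*s^1 + (-1)*x1^1*s^1*t^1 + (-2)*x1^1*s^2 + (4)*x1^2 + (4)*x1^2*s^1 + (-2)*x1^3) * hc

open ComplexConjugate in
theorem fim_poncelet (u1 u2 u3 v1 v2 v3 m C : ℝ)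
    (c1 : u1 ^ 2 + v1 ^ 2 = 1) (c2 : u2 ^ 2 + v2 ^ 2 = 1) (c3 : u3 ^ 2 + v3 ^ 2 = 1)
    (n12 : ¬ (u1 = u2 ∧ v1 = v2)) (n23 : ¬ (u2 = u3 ∧ v2 = v3)) (n31 : ¬ (u3 = u1 ∧ v3 = v1))
    (b12 : (1 - m) * (u1 * u2) + (1 + m) * (v1 * v2) = C)
    (b23 : (1 - m) * (u2 * u3) + (1 + m) * (v2 * v3) = C)
    (b31 : (1 - m) * (u3 * u1) + (1 + m) * (v3 * v1) = C) :
    ∃ p q : ℝ, p ^ 2 + q ^ 2 = 1 ∧ u1 + u2 + u3 = -m * p ∧ v1 + v2 + v3 = -m * q ∧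
      (u1 * u2 + u2 * u3 + u3 * u1) - (v1 * v2 + v2 * v3 + v3 * v1) = -m ∧
      u1 * v2 + v1 * u2 + u2 * v3 + v2 * u3 + u3 * v1 + v3 * u1 = 0 ∧
      p = u1 * u2 * u3 - u1 * v2 * v3 - v1 * u2 * v3 - v1 * v2 * u3 ∧
      q = u1 * u2 * v3 + u1 * v2 * u3 + v1 * u2 * u3 - v1 * v2 * v3 ∧
      2 * C = m ^ 2 - 1 := by
  have key : ∀ u v u' v' : ℝ, u ^ 2 + v ^ 2 = 1 → u' ^ 2 + v' ^ 2 = 1 →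
      (1 - m) * (u * u') + (1 + m) * (v * v') = C →
      (⟨u', v'⟩ : ℂ) ^ 2 * (1 - m * (⟨u, v⟩ : ℂ) ^ 2) - 2 * C * (⟨u, v⟩ : ℂ) * (⟨u', v'⟩ : ℂ)
        + (⟨u, v⟩ : ℂ) ^ 2 - m = 0 := by
    intro u v u' v' h h' hb
    have e : ∀ x y : ℝ, (⟨x, y⟩ : ℂ) = x + y * Complex.I := fun x y => Complex.mk_eq_add_mul_I x y
    have hc : (u : ℂ) ^ 2 + v ^ 2 = 1 := by exact_mod_cast h
    have hc' : (u' : ℂ) ^ 2 + v' ^ 2 = 1 := by exact_mod_cast h'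
    have hbc : (1 - (m : ℂ)) * (u * u') + (1 + m) * (v * v') = C := by exact_mod_cast hb
    set z : ℂ := u + v * Complex.I with hz
    set z' : ℂ := u' + v' * Complex.I with hz'
    set w : ℂ := u - v * Complex.I with hw
    set w' : ℂ := u' - v' * Complex.I with hw'
    have I2 := Complex.I_sq
    have zw : z * w = 1 := by rw [hz, hw]; linear_combination hc - v ^ 2 * I2
    have zw' : z' * w' = 1 := by rw [hz', hw']; linear_combination hc' - v' ^ 2 * I2
    have hr : -m * (z * z' + w * w') + z * w' + w * z' = 2 * C := by
      rw [hz, hw, hz', hw']; linear_combination 2 * hbc - 2 * (v * v') * (1 + m) * I2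
    rw [e, e, ← hz, ← hz']
    linear_combination z * z' * hr + (m - z' ^ 2) * zw + (m * (z * w) - z ^ 2) * zw'
  have k12 := key _ _ _ _ c1 c2 b12
  have k13 := key _ _ _ _ c1 c3 (by linarith [b31])
  have k23 := key _ _ _ _ c2 c3 b23
  have k21 := key _ _ _ _ c2 c1 (by linarith [b12])
  have d12 : (⟨u1, v1⟩ : ℂ) - ⟨u2, v2⟩ ≠ 0 := by
    intro h; apply n12; have := sub_eq_zero.1 h; simpa [Complex.ext_iff] using this
  have d23 : (⟨u2, v2⟩ : ℂ) - ⟨u3, v3⟩ ≠ 0 := by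
    intro h; apply n23; have := sub_eq_zero.1 h; simpa [Complex.ext_iff] using this
  have d31 : (⟨u3, v3⟩ : ℂ) - ⟨u1, v1⟩ ≠ 0 := by
    intro h; apply n31; have := sub_eq_zero.1 h; simpa [Complex.ext_iff] using this
  have q1 : (⟨u1, v1⟩ : ℂ) * conj (⟨u1, v1⟩ : ℂ) = 1 := by
    apply Complex.ext <;> simp <;> nlinarith
  have q2 : (⟨u2, v2⟩ : ℂ) * conj (⟨u2, v2⟩ : ℂ) = 1 := by
    apply Complex.ext <;> simp <;> nlinarith
  have q3 : (⟨u3, v3⟩ : ℂ) * conj (⟨u3, v3⟩ : ℂ) = 1 := by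
    apply Complex.ext <;> simp <;> nlinarith
  obtain ⟨z1, hz1⟩ : ∃ z : ℂ, z = ⟨u1, v1⟩ := ⟨_, rfl⟩
  obtain ⟨z2, hz2⟩ : ∃ z : ℂ, z = ⟨u2, v2⟩ := ⟨_, rfl⟩
  obtain ⟨z3, hz3⟩ : ∃ z : ℂ, z = ⟨u3, v3⟩ := ⟨_, rfl⟩
  simp only [← hz1, ← hz2, ← hz3] at k12 k13 k23 k21 d12 d23 d31 q1 q2 q3
  have s1 : (z2 + z3) * (1 - m * z1 ^ 2) - 2 * C * z1 = 0 := by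
    apply mul_left_cancel₀ d23; linear_combination k12 - k13
  have s2 : (z1 + z3) * (1 - m * z2 ^ 2) - 2 * C * z2 = 0 := by
    apply mul_left_cancel₀ d31; linear_combination k23 - k21
  have t1 : 2 * C + 1 + m * (z1 * z2 + z2 * z3 + z3 * z1) = 0 := by
    apply mul_left_cancel₀ d12; linear_combination s2 - s1
  have S : z1 + z2 + z3 = -m * (z1 * z2 * z3) := by
    linear_combination s1 + z1 * t1
  have Sc := congrArg conj S
  simp only [map_add, map_mul, map_neg, Complex.conj_ofReal] at Sc
  have e2 : z1 * z2 + z2 * z3 + z3 * z1 = -m := by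
    linear_combination (z1 * z2 * z3) * Sc - (z2 * z3) * q1 - (z1 * z3) * q2 - (z1 * z2) * q3
      - m * (z1 * conj z1) * (z2 * conj z2) * q3 - m * (z1 * conj z1) * q2 - m * q1
  have hC : 2 * (C : ℂ) = m ^ 2 - 1 := by linear_combination t1 - m * e2
  have hl : (z1 * z2 * z3) * conj (z1 * z2 * z3) = 1 := by
    simp only [map_mul]
    linear_combination (z1 * conj z1) * (z2 * conj z2) * q3 + (z1 * conj z1) * q2 + q1
  obtain ⟨l, hl'⟩ : ∃ l : ℂ, l = z1 * z2 * z3 := ⟨_, rfl⟩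
  rw [← hl'] at S hl
  subst hz1 hz2 hz3
  refine ⟨l.re, l.im, ?_, ?_, ?_, ?_, ?_, ?_, ?_, by exact_mod_cast hC⟩
  · have := congrArg Complex.re hl; simp at this; linarith
  · have := congrArg Complex.re S; simpa using this
  · have := congrArg Complex.im S; simpa using this
  · have := congrArg Complex.re e2; simp at this; linarith
  · have := congrArg Complex.im e2; simp at this; linarith
  · rw [hl']; simp; ring
  · rw [hl']; simp; ring

theorem fim_sums (u1 u2 u3 v1 v2 v3 m C p q e : ℝ) (m0 : 0 < m) (m1 : m < 1)
    (hE : e ^ 2 * ((3 - m) * (1 + m)) = 4 * m)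
    (c1 : u1 ^ 2 + v1 ^ 2 = 1) (c2 : u2 ^ 2 + v2 ^ 2 = 1) (c3 : u3 ^ 2 + v3 ^ 2 = 1)
    (b12 : (1 - m) * (u1 * u2) + (1 + m) * (v1 * v2) = C)
    (b23 : (1 - m) * (u2 * u3) + (1 + m) * (v2 * v3) = C)
    (b31 : (1 - m) * (u3 * u1) + (1 + m) * (v3 * v1) = C)
    (hpq : p ^ 2 + q ^ 2 = 1) (hu : u1 + u2 + u3 = -m * p) (hv : v1 + v2 + v3 = -m * q)
    (h4 : (u1 * u2 + u2 * u3 + u3 * u1) - (v1 * v2 + v2 * v3 + v3 * v1) = -m)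
    (h5 : u1 * v2 + v1 * u2 + u2 * v3 + v2 * u3 + u3 * v1 + v3 * u1 = 0)
    (hp : p = u1 * u2 * u3 - u1 * v2 * v3 - v1 * u2 * v3 - v1 * v2 * u3)
    (hq : q = u1 * u2 * v3 + u1 * v2 * u3 + v1 * u2 * u3 - v1 * v2 * v3)
    (hC : 2 * C = m ^ 2 - 1) (s t : ℝ) (hs : s = -m * p * e) (ht : t * (3 - m) = 1 + m) :
    e * u1 + e * u2 + e * u3 = s ∧
    (e * u1) * (e * u2) + (e * u2) * (e * u3) + (e * u3) * (e * u1) = -m ∧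
    (e * u1) * (e * u2) * (e * u3) = -(t * s) ∧
    (e * u1) * v1 + (e * u2) * v2 + (e * u3) * v3 = -m * s * q ∧
    (e * u1) ^ 2 * v1 + (e * u2) ^ 2 * v2 + (e * u3) ^ 2 * v3 = q * (-m * s ^ 2 + m * (1 - m)) := by
  have huu : 4 * (u1 * u2 + u2 * u3 + u3 * u1) = (m - 3) * (m + 1) := by
    linear_combination 2 * h4 + (u1 + u2 + u3 - m * p) * hu + (v1 + v2 + v3 - m * q) * hv
      + m ^ 2 * hpq - c1 - c2 - c3
  have huuu : 4 * (u1 * u2 * u3) = (1 + m) ^ 2 * p := by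
    have h2 : (4 - 2 * m) ≠ 0 := by linarith
    apply mul_left_cancel₀ h2
    linear_combination 4 * u1 * b23 + 4 * u2 * b31 + 4 * u3 * b12 + 4 * C * hu - 2 * m * p * hC
      - 4 * (1 + m) * hp
  have huuv : 4 * (u1 * u2 * v3 + u1 * v2 * u3 + v1 * u2 * u3) = q * (1 + m) * (3 - m) := by
    have h2 : (4 + 2 * m) ≠ 0 := by linarith
    apply mul_left_cancel₀ h2
    linear_combination 4 * v1 * b23 + 4 * v2 * b31 + 4 * v3 * b12 + 4 * C * hv - 2 * m * q * hC
      - 12 * (1 + m) * hq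
  have huv : u1 * v1 + u2 * v2 + u3 * v3 = m ^ 2 * p * q := by
    linear_combination (v1 + v2 + v3) * hu - m * p * hv - h5
  have huuv2 : 4 * (u1 ^ 2 * v1 + u2 ^ 2 * v2 + u3 ^ 2 * v3) =
      q * (-4 * m ^ 3 * p ^ 2 + (1 - m) * (1 + m) * (3 - m)) := by
    linear_combination 4 * (u1 * v1 + u2 * v2 + u3 * v3) * hu - 4 * m * p * huv
      - (v1 + v2 + v3) * huu - (m - 3) * (m + 1) * hv + huuv
  have h3m : (3 - m) ≠ 0 := by linarith
  refine ⟨?_, ?_, ?_, ?_, ?_⟩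
  · linear_combination e * hu - hs
  · linear_combination e ^ 2 / 4 * huu - hE / 4
  · apply mul_left_cancel₀ h3m
    linear_combination (3 - m) * e ^ 3 / 4 * huuu + (1 + m) * p * e / 4 * hE + s * ht + (1 + m) * hs
  · linear_combination e * huv + m * q * hs
  · linear_combination e ^ 2 / 4 * huuv2 + q * (1 - m) / 4 * hE + q * m * (s - m * p * e) * hs

/-- Sums of the Mittenpunkt weights against powers. -/
theorem fim_final (x1 x2 x3 v1 v2 v3 s m t q E : ℝ) (m0 : 0 < m) (m1 : m < 1)
    (hE : E * ((3 - m) * (1 + m)) = 4 * m) (ht : t * (3 - m) = 1 + m)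
    (h1 : x1 + x2 + x3 = s)
    (h2 : x1 * x2 + x2 * x3 + x3 * x1 = -m) (h3 : x1 * x2 * x3 = -(t * s))
    (hv : v1 + v2 + v3 = -m * q)
    (hxv : x1 * v1 + x2 * v2 + x3 * v3 = -m * s * q)
    (hxxv : x1 ^ 2 * v1 + x2 ^ 2 * v2 + x3 ^ 2 * v3 = q * (-m * s ^ 2 + m * (1 - m)))
    (l1 l2 l3 W g1 g2 g3 : ℝ) (hl1 : l1 = (1 + x1) * (1 - x2 * x3))
    (hl2 : l2 = (1 + x2) * (1 - x3 * x1)) (hl3 : l3 = (1 + x3) * (1 - x1 * x2))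
    (hW : W = l1 * (l2 + l3 - l1) + l2 * (l3 + l1 - l2) + l3 * (l1 + l2 - l3))
    (hg1 : g1 = (1 - x2 * x3) * (l2 + l3 - l1) * ((1 + x2) * (1 + x3)))
    (hg2 : g2 = (1 - x3 * x1) * (l3 + l1 - l2) * ((1 + x3) * (1 + x1)))
    (hg3 : g3 = (1 - x1 * x2) * (l1 + l2 - l3) * ((1 + x1) * (1 + x2))) :
    W * (3 - m) ^ 2 = (3 + m) * (1 - m) * ((3 - m) ^ 2 - 4 * s ^ 2) ∧
    g1 * v1 + g2 * v2 + g3 * v3 = m * q * W ∧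
    (3 + m) * (g1 * (x1 + E) + g2 * (x2 + E) + g3 * (x3 + E)) = 
     W * ((3 - m) * (-s) - 2 * m ^ 2 * E - E * (1 + m) * ((3 - m) + 2 * s) / 2) ∧
    (1 + x1) * (1 + x2) * (1 + x3) * (3 - m) = (1 - m) * (3 - m + 2 * s) := by
  have G1 := fim_core_g x1 x2 x3 s m t h1 h2 h3
  have G2 := fim_core_g x2 x3 x1 s m t (by linarith) (by linarith) (by linarith)
  have G3 := fim_core_g x3 x1 x2 s m t (by linarith) (by linarith) (by linarith)
  rw [← hl1, ← hl2, ← hl3, ← hg1] at G1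
  rw [← hl1, ← hl2, ← hl3, ← hg2] at G2
  rw [← hl1, ← hl2, ← hl3, ← hg3] at G3
  have hW1 : W = (3 + m) * (1 - m) - 2 * t * s ^ 2 + 3 * t ^ 2 * s ^ 2 - s ^ 2 := by
    have hm : m = -(x1 * x2 + x2 * x3 + x3 * x1) := by linarith
    have hT : t * s = -(x1 * x2 * x3) := by linarith
    have : W = (3 + m) * (1 - m) + 2 * s * (1 + m) + (6 - 2 * m) * (x1 * x2 * x3)
        + 2 * (x1 * x2 * x3) * s + 3 * (x1 * x2 * x3) ^ 2 - s ^ 2 := by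
      rw [hW, hl1, hl2, hl3, hm, ← h1]; ring
    rw [this, h3]; linear_combination -2 * s * ht
  have h3m : (3 - m) ≠ 0 := by linarith
  have h1m : (1 + m) ≠ 0 := by linarith
  have tt : t = (1 + m) / (3 - m) := by field_simp; linarith
  have EE : E = 4 * m / ((3 - m) * (1 + m)) := by field_simp; linarith
  have x2s : x1 ^ 2 + x2 ^ 2 + x3 ^ 2 = s ^ 2 + 2 * m := by
    linear_combination (x1 + x2 + x3 + s) * h1 - 2 * h2
  have x3s : x1 ^ 3 + x2 ^ 3 + x3 ^ 3 = s * (s ^ 2 + 2 * m) + m * s - 3 * t * s := by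
    linear_combination (x1 ^ 2 + x2 ^ 2 + x3 ^ 2) * h1 + s * x2s - (x1 + x2 + x3) * h2 + m * h1 + 3 * h3
  generalize hα : (1 - m - m^2 + m^3 + 2*s + 2*s*t + 3*s*m*t - 2*s*m^2 - s*m^2*t + s^2 - 3*s^2*t
      - 3*s^2*t^2 + s^2*m + 4*s^2*m*t - 3*s^3*t - s^3*t^2) = α at G1 G2 G3
  generalize hβ : (-3 - m - 5*s + 2*s*t - s*m - s*m*t + s*m^2 - s^2 + 7*s^2*t + s^2*t^2 - 2*s^2*m
      - s^2*m*t + s^3 + 3*s^3*t) = β at G1 G2 G3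
  generalize hγ : (4 + m - m^2 + s - 4*s*t + 2*s*m + s*m*t - s^2 - 3*s^2*t) = γ at G1 G2 G3
  refine ⟨?_, ?_, ?_, ?_⟩
  · rw [hW1, tt]; field_simp; ring
  · have : g1 * v1 + g2 * v2 + g3 * v3 = m * q * (-α - β * s + γ * (1 - m - s ^ 2)) := by
      linear_combination v1 * G1 + v2 * G2 + v3 * G3 + α * hv + β * hxv + γ * hxxv
    rw [this, hW1, ← hα, ← hβ, ← hγ, tt]; field_simp; ring
  · have : g1 * (x1 + E) + g2 * (x2 + E) + g3 * (x3 + E) =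
      α * s + β * (s ^ 2 + 2 * m) + γ * (s * (s ^ 2 + 2 * m) + m * s - 3 * t * s)
      + E * (3 * α + β * s + γ * (s ^ 2 + 2 * m)) := by
      linear_combination (x1 + E) * G1 + (x2 + E) * G2 + (x3 + E) * G3 + (α + E * β) * h1
        + (β + E * γ) * x2s + γ * x3s
    rw [this, hW1, ← hα, ← hβ, ← hγ, EE, tt]; field_simp; ring
  · linear_combination (3 - m) * (h1 + h2 + h3) - s * ht

theorem fim_s_lt (m p q e s : ℝ) (m0 : 0 < m) (m1 : m < 1) (e0 : 0 < e) (e1 : e < 1)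
    (hpq : p ^ 2 + q ^ 2 = 1) (hs : s = -m * p * e) : s ^ 2 < 1 := by
  have p2 : p ^ 2 ≤ 1 := by linarith [sq_nonneg q]
  have me : (m * e) ^ 2 < 1 := by
    have h1 : m * e < 1 := mul_lt_one_of_nonneg_of_lt_one_left m0.le m1 e1.le
    have h2 : 0 ≤ m * e := by positivity
    exact pow_lt_one₀ h2 h1 two_ne_zero
  have h : s ^ 2 = p ^ 2 * (m * e) ^ 2 := by rw [hs]; ring
  rw [h]
  exact mul_lt_one_of_nonneg_of_lt_one_right p2 (by positivity) me

theorem fim_s_bounds (m s : ℝ) (m1 : m < 1) (hs : s ^ 2 < 1) :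
    0 < (3 - m) ^ 2 - 4 * s ^ 2 ∧ 0 < 3 - m + 2 * s := by
  have h := abs_lt.1 ((sq_lt_one_iff_abs_lt_one s).1 hs)
  constructor <;> nlinarith [h.1, h.2]

theorem fim_circle (u1 u2 u3 v1 v2 v3 m C p q e B : ℝ) (m0 : 0 < m) (m1 : m < 1)
    (e0 : 0 < e) (e1 : e < 1) (hB : B = 1 - e ^ 2)
    (hE : e ^ 2 * ((3 - m) * (1 + m)) = 4 * m)
    (c1 : u1 ^ 2 + v1 ^ 2 = 1) (c2 : u2 ^ 2 + v2 ^ 2 = 1) (c3 : u3 ^ 2 + v3 ^ 2 = 1)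
    (b12 : (1 - m) * (u1 * u2) + (1 + m) * (v1 * v2) = C)
    (b23 : (1 - m) * (u2 * u3) + (1 + m) * (v2 * v3) = C)
    (b31 : (1 - m) * (u3 * u1) + (1 + m) * (v3 * v1) = C)
    (hpq : p ^ 2 + q ^ 2 = 1) (hu : u1 + u2 + u3 = -m * p) (hv : v1 + v2 + v3 = -m * q)
    (h4 : (u1 * u2 + u2 * u3 + u3 * u1) - (v1 * v2 + v2 * v3 + v3 * v1) = -m)
    (h5 : u1 * v2 + v1 * u2 + u2 * v3 + v2 * u3 + u3 * v1 + v3 * u1 = 0)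
    (hp : p = u1 * u2 * u3 - u1 * v2 * v3 - v1 * u2 * v3 - v1 * v2 * u3)
    (hq : q = u1 * u2 * v3 + u1 * v2 * u3 + v1 * u2 * u3 - v1 * v2 * v3)
    (hC : 2 * C = m ^ 2 - 1)
    (l1 l2 l3 w1 w2 w3 W : ℝ) (hl1 : l1 = (1 + e * u1) * (1 - (e * u2) * (e * u3)))
    (hl2 : l2 = (1 + e * u2) * (1 - (e * u3) * (e * u1)))
    (hl3 : l3 = (1 + e * u3) * (1 - (e * u1) * (e * u2)))
    (hw1 : w1 = l1 * (l2 + l3 - l1)) (hw2 : w2 = l2 * (l3 + l1 - l2))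
    (hw3 : w3 = l3 * (l1 + l2 - l3)) (hW : W = w1 + w2 + w3) :
    W ≠ 0 ∧ (W⁻¹ * (w1 * ((u1 + e) / (1 + e * u1) ^ 2) + w2 * ((u2 + e) / (1 + e * u2) ^ 2)
        + w3 * ((u3 + e) / (1 + e * u3) ^ 2)) + e / (2 * B)) ^ 2
      + B * (W⁻¹ * (w1 * (v1 / (1 + e * u1) ^ 2) + w2 * (v2 / (1 + e * u2) ^ 2)
        + w3 * (v3 / (1 + e * u3) ^ 2))) ^ 2 = (m * (3 - m) / ((3 + m) * (1 - m))) ^ 2 := by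
  obtain ⟨s, hs⟩ : ∃ s, s = -m * p * e := ⟨_, rfl⟩
  have h3m : 0 < 3 - m := by linarith
  have h1m : 0 < 1 - m := by linarith
  obtain ⟨t, ht⟩ : ∃ t, t * (3 - m) = 1 + m := ⟨(1 + m) / (3 - m), by field_simp⟩
  obtain ⟨f1, f2, f3, f4, f5⟩ := fim_sums u1 u2 u3 v1 v2 v3 m C p q e m0 m1 hE c1 c2 c3 b12 b23 b31
    hpq hu hv h4 h5 hp hq hC s t hs ht
  have hs2 : s ^ 2 < 1 := fim_s_lt m p q e s m0 m1 e0 e1 hpq hs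
  obtain ⟨g1, hg1⟩ : ∃ g, g = (1 - (e * u2) * (e * u3)) * (l2 + l3 - l1)
    * ((1 + (e * u2)) * (1 + (e * u3))) := ⟨_, rfl⟩
  obtain ⟨g2, hg2⟩ : ∃ g, g = (1 - (e * u3) * (e * u1)) * (l3 + l1 - l2)
    * ((1 + (e * u3)) * (1 + (e * u1))) := ⟨_, rfl⟩
  obtain ⟨g3, hg3⟩ : ∃ g, g = (1 - (e * u1) * (e * u2)) * (l1 + l2 - l3)
    * ((1 + (e * u1)) * (1 + (e * u2))) := ⟨_, rfl⟩
  obtain ⟨k1, k2, k3, k4⟩ := fim_final (e * u1) (e * u2) (e * u3) v1 v2 v3 s m t q (e ^ 2) m0 m1 hE ht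
    f1 f2 f3 hv f4 f5 l1 l2 l3 W g1 g2 g3 hl1 hl2 hl3 (by rw [hW, hw1, hw2, hw3]) hg1 hg2 hg3
  have W0 : W ≠ 0 := by
    rintro rfl
    have : 0 < (3 + m) * (1 - m) * ((3 - m) ^ 2 - 4 * s ^ 2) := by
      have := (fim_s_bounds m s m1 hs2).1
      positivity
    linarith
  have Hp : 0 < 3 - m + 2 * s := (fim_s_bounds m s m1 hs2).2
  obtain ⟨G, hG⟩ : ∃ G, G = (1 + e * u1) * (1 + e * u2) * (1 + e * u3) := ⟨_, rfl⟩
  rw [← hG] at k4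
  have G0 : G ≠ 0 := by
    rintro rfl
    have : 0 < (1 - m) * (3 - m + 2 * s) := by positivity
    linarith
  have r1 : 1 + e * u1 ≠ 0 := by intro h; apply G0; rw [hG, h]; ring
  have r2 : 1 + e * u2 ≠ 0 := by intro h; apply G0; rw [hG, h]; ring
  have r3 : 1 + e * u3 ≠ 0 := by intro h; apply G0; rw [hG, h]; ring
  have a1 : ∀ y, w1 * (y / (1 + e * u1) ^ 2) = g1 * y / G := by
    intro y; rw [hw1, hg1, hG]; nth_rewrite 1 [hl1]; field_simp
  have a2 : ∀ y, w2 * (y / (1 + e * u2) ^ 2) = g2 * y / G := by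
    intro y; rw [hw2, hg2, hG]; nth_rewrite 1 [hl2]; field_simp
  have a3 : ∀ y, w3 * (y / (1 + e * u3) ^ 2) = g3 * y / G := by
    intro y; rw [hw3, hg3, hG]; nth_rewrite 1 [hl3]; field_simp
  refine ⟨W0, ?_⟩
  have B0 : B * ((3 - m) * (1 + m)) = (3 + m) * (1 - m) := by
    rw [hB]; linear_combination -hE
  have Bpos : B ≠ 0 := by
    intro h; rw [h] at B0
    have : 0 < (3 + m) * (1 - m) := by positivity
    linarith
  have V : W⁻¹ * (w1 * (v1 / (1 + e * u1) ^ 2) + w2 * (v2 / (1 + e * u2) ^ 2)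
        + w3 * (v3 / (1 + e * u3) ^ 2)) = m * q / G := by
    rw [a1, a2, a3, ← add_div, ← add_div, k2]; field_simp
  have X : W⁻¹ * (w1 * ((u1 + e) / (1 + e * u1) ^ 2) + w2 * ((u2 + e) / (1 + e * u2) ^ 2)
        + w3 * ((u3 + e) / (1 + e * u3) ^ 2)) + e / (2 * B) =
      m * ((3 - m) * p - 2 * m * e) / ((3 + m) * G) := by
    rw [a1, a2, a3, ← add_div, ← add_div]
    have hX : (3 + m) * (g1 * (u1 + e) + g2 * (u2 + e) + g3 * (u3 + e)) = 
        W * (m * ((3 - m) * p - 2 * m * e) - e * (1 + m) * (3 - m + 2 * s) / 2) := by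
      apply mul_left_cancel₀ e0.ne'
      rw [hs] at k3 ⊢
      linear_combination k3
    have hX' : g1 * (u1 + e) + g2 * (u2 + e) + g3 * (u3 + e) =
      W * (m * ((3 - m) * p - 2 * m * e) - e * (1 + m) * (3 - m + 2 * s) / 2) / (3 + m) := by
      rw [← hX]; field_simp
    have h2 : e / (2 * B) = e * (1 + m) * (3 - m + 2 * s) / 2 / ((3 + m) * G) := by
      rw [div_eq_div_iff (by positivity) (by positivity)]
      apply mul_left_cancel₀ (mul_pos h3m h1m).ne'
      linear_combination e * (1 - m) * (3 + m) * k4 - e * (1 - m) * (3 - m + 2 * s) * B0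
    rw [hX', h2]; field_simp; ring
  rw [X, V]
  have hH : G = (1 - m) * (3 - m + 2 * s) / (3 - m) := by
    rw [← k4]; field_simp
  have hBe : (3 + m) ^ 2 * B = (3 - m) ^ 2 - 4 * m ^ 2 * e ^ 2 := by
    apply mul_left_cancel₀ (show (3 - m) * (1 + m) ≠ 0 by positivity)
    linear_combination (3 + m) ^ 2 * B0 + 4 * m ^ 2 * hE
  have id : ((3 - m) * p - 2 * m * e) ^ 2 + (3 + m) ^ 2 * B * q ^ 2 = (3 - m + 2 * s) ^ 2 := by
    rw [hBe, hs]; linear_combination ((3 - m) ^ 2 - 4 * m ^ 2 * e ^ 2) * hpq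
  have : (m * ((3 - m) * p - 2 * m * e) / ((3 + m) * G)) ^ 2 + B * (m * q / G) ^ 2 =
      m ^ 2 * (((3 - m) * p - 2 * m * e) ^ 2 + (3 + m) ^ 2 * B * q ^ 2) / ((3 + m) * G) ^ 2 := by
    field_simp
  rw [this, id, hH]; field_simp

namespace BilliardInv

theorem fim_dst_inva (ρ r r' : ℝ) (f P Q : Pt) (hr : 0 < r) (hr' : 0 < r')
    (h : (P.1 - f.1) ^ 2 + (P.2 - f.2) ^ 2 = r ^ 2)
    (h' : (Q.1 - f.1) ^ 2 + (Q.2 - f.2) ^ 2 = r' ^ 2) :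
    dst (inva ρ f P) (inva ρ f Q) = ρ ^ 2 / (r * r') * dst P Q := by
  have e : ρ ^ 2 / (r * r') * dst P Q =
      Real.sqrt ((ρ ^ 2 / (r * r')) ^ 2 * ((P.1 - Q.1) ^ 2 + (P.2 - Q.2) ^ 2)) := by
    rw [Real.sqrt_mul (by positivity), Real.sqrt_sq (by positivity), dst]
  rw [e, dst]
  congr 1
  simp only [inva, h, h', Prod.fst_add, Prod.snd_add, Prod.smul_fst, Prod.smul_snd,
    Prod.fst_sub, Prod.snd_sub, smul_eq_mul]
  field_simp
  linear_combination ρ ^ 4 * (r' ^ 4 - r' ^ 2 * r ^ 2) * h + ρ ^ 4 * (r ^ 4 - r ^ 2 * r' ^ 2) * h'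

theorem fim_mitten_scale (K l1 l2 l3 : ℝ) (A B C : Pt) (hK : K ≠ 0)
    (h1 : dst B C = K * l1) (h2 : dst C A = K * l2) (h3 : dst A B = K * l3) :
    mittenpunkt A B C = bary (l1 * (l2 + l3 - l1)) (l2 * (l3 + l1 - l2)) (l3 * (l1 + l2 - l3))
      A B C := by
  simp only [mittenpunkt, sA, sB, sC, h1, h2, h3, bary]
  have e1 : K * l1 * (K * l2 + K * l3 - K * l1) = K ^ 2 * (l1 * (l2 + l3 - l1)) := by ring
  have e2 : K * l2 * (K * l3 + K * l1 - K * l2) = K ^ 2 * (l2 * (l3 + l1 - l2)) := by ring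
  have e3 : K * l3 * (K * l1 + K * l2 - K * l3) = K ^ 2 * (l3 * (l1 + l2 - l3)) := by ring
  rw [e1, e2, e3, ← mul_add, ← mul_add, mul_inv]
  simp only [mul_smul, ← smul_add]
  rw [smul_comm, inv_smul_smul₀ (pow_ne_zero 2 hK)]

theorem fim_dst_comm (P Q : Pt) : dst P Q = dst Q P := by
  unfold dst; congr 1; ring

theorem fim_dst_pos (P Q : Pt) (h : P ≠ Q) : 0 < dst P Q := by
  unfold dst
  apply Real.sqrt_pos.2
  by_contra hh
  apply h
  have h1 : (P.1 - Q.1) ^ 2 = 0 := by nlinarith [sq_nonneg (P.1 - Q.1), sq_nonneg (P.2 - Q.2)]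
  have h2 : (P.2 - Q.2) ^ 2 = 0 := by nlinarith [sq_nonneg (P.1 - Q.1), sq_nonneg (P.2 - Q.2)]
  have := pow_eq_zero_iff (two_ne_zero) |>.1 h1
  have := pow_eq_zero_iff (two_ne_zero) |>.1 h2
  ext <;> linarith

theorem fim_dst_sq (P Q : Pt) : dst P Q ^ 2 = (P.1 - Q.1) ^ 2 + (P.2 - Q.2) ^ 2 := by
  unfold dst; exact Real.sq_sqrt (by positivity)

/-- Joachimsthal quantity in normalized coordinates. -/
theorem fim_dot (a b u v u' v' : ℝ) (ha : a ≠ 0) (hb : b ≠ 0) (h : u ^ 2 + v ^ 2 = 1) :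
    dot (udir (a * u, b * v) (a * u', b * v')) (nrm a b (a * u, b * v)) =
      -((1 - u * u' - v * v') / dst (a * u, b * v) (a * u', b * v')) := by
  simp only [dot, udir, nrm, Prod.smul_fst, Prod.smul_snd, Prod.fst_sub, Prod.snd_sub, smul_eq_mul]
  rw [div_eq_mul_inv _ (dst _ _)]
  field_simp
  linear_combination -(dst (a * u, b * v) (a * u', b * v'))⁻¹ * h

end BilliardInv

namespace BilliardInv

theorem fim_param (a b : ℝ) (P : Pt) (ha : a ≠ 0) (hb : b ≠ 0) (h : onEllipse a b P) :
    ∃ u v, P = (a * u, b * v) ∧ u ^ 2 + v ^ 2 = 1 := by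
  refine ⟨P.1 / a, P.2 / b, ?_, ?_⟩
  · ext
    · simp only []; field_simp
    · simp only []; field_simp
  · rw [div_pow, div_pow]; exact h

theorem fim_bilinear (a b c J u v u' v' : ℝ) (hc : c ^ 2 = a ^ 2 - b ^ 2)
    (h : u ^ 2 + v ^ 2 = 1) (h' : u' ^ 2 + v' ^ 2 = 1)
    (hne : ((a * u, b * v) : Pt) ≠ (a * u', b * v'))
    (hJ : 1 - u * u' - v * v' = J * dst (a * u, b * v) (a * u', b * v')) :
    ¬ (u = u' ∧ v = v') ∧ 0 < 1 - u * u' - v * v' ∧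
    (1 - J ^ 2 * c ^ 2) * (u * u') + (1 + J ^ 2 * c ^ 2) * (v * v') = 1 - J ^ 2 * (a ^ 2 + b ^ 2) := by
  have hn : ¬ (u = u' ∧ v = v') := by
    rintro ⟨rfl, rfl⟩; exact hne rfl
  have hD : 0 < 1 - u * u' - v * v' := by
    have e : 1 - u * u' - v * v' = ((u - u') ^ 2 + (v - v') ^ 2) / 2 := by
      linear_combination -h / 2 - h' / 2
    rw [e]
    rcases eq_or_ne u u' with hu | hu
    · have : v - v' ≠ 0 := fun hv => hn ⟨hu, by linarith⟩
      positivity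
    · have : u - u' ≠ 0 := sub_ne_zero.2 hu
      positivity
  refine ⟨hn, hD, ?_⟩
  have hd := fim_dst_sq (a * u, b * v) (a * u', b * v')
  have hd2 : dst (a * u, b * v) (a * u', b * v') ^ 2 =
      (1 - u * u' - v * v') * (a ^ 2 + b ^ 2 - c ^ 2 * (u * u' - v * v')) := by
    rw [hd, hc]
    simp only []
    have hv : v ^ 2 = 1 - u ^ 2 := by linarith
    have hv' : v' ^ 2 = 1 - u' ^ 2 := by linarith
    grind
  apply mul_left_cancel₀ hD.ne'
  have hJ2 : (1 - u * u' - v * v') ^ 2 = J ^ 2 * dst (a * u, b * v) (a * u', b * v') ^ 2 := by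
    rw [hJ]; ring
  rw [hd2] at hJ2
  linear_combination -hJ2

theorem fim_e_lt (e : ℝ) (h : e ^ 2 < 1) : e < 1 :=
  (abs_lt.1 ((sq_lt_one_iff_abs_lt_one e).1 h)).2

theorem fim_delta_nonneg (m e : ℝ) (m0 : 0 < m) (h : e ^ 2 < 1) :
    0 ≤ 1 + (m - 1) * e ^ 2 / 2 := by
  have := mul_nonneg m0.le (sq_nonneg e)
  linarith

theorem fim_m_lt (m e : ℝ) (m0 : 0 < m) (e0 : 0 < e) (e1 : e < 1)
    (hE : e ^ 2 * ((3 - m) * (1 + m)) = 4 * m) : m < 1 := by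
  have he : e ^ 2 < 1 := pow_lt_one₀ e0.le e1 two_ne_zero
  have hp : 0 < (3 - m) * (1 + m) := by
    have : 0 < e ^ 2 * ((3 - m) * (1 + m)) := by rw [hE]; linarith
    exact pos_of_mul_pos_right this (by positivity)
  by_contra hm
  push Not at hm
  nlinarith

theorem fim_side (m C e u v u' v' : ℝ) (m0 : 0 < m)
    (hE : e ^ 2 * ((3 - m) * (1 + m)) = 4 * m) (hC : 2 * C = m ^ 2 - 1)
    (hb : (1 - m) * (u * u') + (1 + m) * (v * v') = C) :
    1 - u * u' - v * v' = (3 - m) / 2 * (1 - (e * u) * (e * u')) := by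
  apply mul_left_cancel₀ (show 1 + m ≠ 0 by linarith)
  linear_combination -hb - hC / 2 + (u * u') / 2 * hE

theorem fim_pos (u v e : ℝ) (e0 : 0 < e) (e1 : e < 1) (h : u ^ 2 + v ^ 2 = 1) :
    0 < 1 + e * u := by
  have : -1 ≤ u := by nlinarith [sq_nonneg v]
  nlinarith

theorem fim_focal (a β e u v : ℝ) (hB : β ^ 2 = 1 - e ^ 2) (h : u ^ 2 + v ^ 2 = 1) :
    (((a * u, β * a * v) : Pt).1 - ((-(e * a), 0) : Pt).1) ^ 2
      + (((a * u, β * a * v) : Pt).2 - ((-(e * a), 0) : Pt).2) ^ 2 = (a * (1 + e * u)) ^ 2 := by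
  simp only []
  linear_combination a ^ 2 * v ^ 2 * hB + a ^ 2 * (1 - e ^ 2) * h

end BilliardInv


theorem fim_end (a ρ e β u1 u2 u3 v1 v2 v3 w1 w2 w3 : ℝ) (ha : a ≠ 0) (hβ : β ≠ 0)
    (h1 : 1 + e * u1 ≠ 0) (h2 : 1 + e * u2 ≠ 0) (h3 : 1 + e * u3 ≠ 0) (W0 : w1 + w2 + w3 ≠ 0) :
    ((w1 + w2 + w3)⁻¹ *
            (w1 * (-(e * a) + ρ ^ 2 / (a * (1 + e * u1)) ^ 2 * (a * u1 - -(e * a))) +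
                w2 * (-(e * a) + ρ ^ 2 / (a * (1 + e * u2)) ^ 2 * (a * u2 - -(e * a))) +
              w3 * (-(e * a) + ρ ^ 2 / (a * (1 + e * u3)) ^ 2 * (a * u3 - -(e * a)))) -
          -(e * a) * (1 + ρ ^ 2 / (2 * (β * a) ^ 2))) ^ 2 +
      ((w1 + w2 + w3)⁻¹ *
            (w1 * (0 + ρ ^ 2 / (a * (1 + e * u1)) ^ 2 * (β * a * v1 - 0)) +
                w2 * (0 + ρ ^ 2 / (a * (1 + e * u2)) ^ 2 * (β * a * v2 - 0)) +
              w3 * (0 + ρ ^ 2 / (a * (1 + e * u3)) ^ 2 * (β * a * v3 - 0))) - 0) ^ 2 =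
    (ρ ^ 2 / a) ^ 2 *
      (((w1 + w2 + w3)⁻¹ *
              (w1 * ((u1 + e) / (1 + e * u1) ^ 2) + w2 * ((u2 + e) / (1 + e * u2) ^ 2) +
                w3 * ((u3 + e) / (1 + e * u3) ^ 2)) + e / (2 * β ^ 2)) ^ 2 +
        β ^ 2 *
          ((w1 + w2 + w3)⁻¹ *
              (w1 * (v1 / (1 + e * u1) ^ 2) + w2 * (v2 / (1 + e * u2) ^ 2) +
                w3 * (v3 / (1 + e * u3) ^ 2))) ^ 2) := by
  have X : ∀ u x : ℝ, x ≠ 0 → ρ ^ 2 / (a * x) ^ 2 * (a * u - -(e * a))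
      = ρ ^ 2 / a * ((u + e) / x ^ 2) := by
    intro u x hx; field_simp; ring
  have Y : ∀ v x : ℝ, x ≠ 0 → ρ ^ 2 / (a * x) ^ 2 * (β * a * v - 0)
      = ρ ^ 2 / a * β * (v / x ^ 2) := by
    intro u x hx; rw [sub_zero]; field_simp
  have Z : -(e * a) * (1 + ρ ^ 2 / (2 * (β * a) ^ 2))
      = -(e * a) - ρ ^ 2 / a * (e / (2 * β ^ 2)) := by
    field_simp; ring
  rw [X _ _ h1, X _ _ h2, X _ _ h3, Y _ _ h1, Y _ _ h2, Y _ _ h3, Z]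
  have W1 := inv_mul_cancel₀ W0
  generalize (w1 + w2 + w3)⁻¹ = t at *
  generalize (u1 + e) / (1 + e * u1) ^ 2 = X1
  generalize (u2 + e) / (1 + e * u2) ^ 2 = X2
  generalize (u3 + e) / (1 + e * u3) ^ 2 = X3
  generalize v1 / (1 + e * u1) ^ 2 = Y1
  generalize v2 / (1 + e * u2) ^ 2 = Y2
  generalize v3 / (1 + e * u3) ^ 2 = Y3
  generalize e / (2 * β ^ 2) = d
  generalize ρ ^ 2 / a = k
  have A : t * (w1 * (-(e * a) + k * X1) + w2 * (-(e * a) + k * X2) + w3 * (-(e * a) + k * X3))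
      - (-(e * a) - k * d) = k * (t * (w1 * X1 + w2 * X2 + w3 * X3) + d) := by
    linear_combination (-(e * a)) * W1
  rw [A]
  ring

set_option maxHeartbeats 2000000 in
/-- the Mittenpunkt of the focus-inversive triangle moves along the
circle with center (−c(1 + ρ²/(2b²)), 0) and radius ρ²(2a² − b² − δ)/(2ab²). -/
theorem focus_inversive_mittenpunkt_circle (a b ρ : ℝ) (hab : a > b) (hb : b > 0)
    (hρ : ρ > 0) (T : Orbit3 a b) :
    let c : ℝ := Real.sqrt (a ^ 2 - b ^ 2)
    let δ : ℝ := Real.sqrt (a ^ 4 - a ^ 2 * b ^ 2 + b ^ 4)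
    let f1 : Pt := (-c, 0)
    let C9 : Pt := (-c * (1 + ρ ^ 2 / (2 * b ^ 2)), 0)
    dst (mittenpunkt (inva ρ f1 T.P1) (inva ρ f1 T.P2) (inva ρ f1 T.P3)) C9 =
      ρ ^ 2 * (2 * a ^ 2 - b ^ 2 - δ) / (2 * a * b ^ 2) := by
  
  intro c δ f1 C9
  have ha : 0 < a := lt_trans hb hab
  have hc2 : c ^ 2 = a ^ 2 - b ^ 2 := Real.sq_sqrt (by nlinarith)
  have hc0 : 0 < c := Real.sqrt_pos.2 (by nlinarith)
  have hδ : δ = Real.sqrt (a ^ 4 - a ^ 2 * b ^ 2 + b ^ 4) := rfl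
  have hf1 : f1 = (-c, 0) := rfl
  have hC9 : C9 = (-c * (1 + ρ ^ 2 / (2 * b ^ 2)), 0) := rfl
  clear_value c δ f1 C9
  obtain ⟨P1, P2, P3, h1, h2, h3, d12, d23, d31, r1, r2, r3⟩ := T
  obtain ⟨u1, v1, rfl, c1⟩ := fim_param a b P1 ha.ne' hb.ne' h1
  obtain ⟨u2, v2, rfl, c2⟩ := fim_param a b P2 ha.ne' hb.ne' h2
  obtain ⟨u3, v3, rfl, c3⟩ := fim_param a b P3 ha.ne' hb.ne' h3
  show dst (mittenpunkt (inva ρ f1 (a * u1, b * v1)) (inva ρ f1 (a * u2, b * v2))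
    (inva ρ f1 (a * u3, b * v3))) C9 = _
  -- Joachimsthal
  simp only [reflectAt] at r1 r2 r3
  rw [fim_dot a b _ _ _ _ ha.ne' hb.ne' c1, fim_dot a b _ _ _ _ ha.ne' hb.ne' c1] at r1
  rw [fim_dot a b _ _ _ _ ha.ne' hb.ne' c2, fim_dot a b _ _ _ _ ha.ne' hb.ne' c2] at r2
  rw [fim_dst_comm (a * u1, b * v1) (a * u3, b * v3)] at r1
  rw [fim_dst_comm (a * u2, b * v2) (a * u1, b * v1)] at r2
  have p12 := fim_dst_pos _ _ d12
  have p23 := fim_dst_pos _ _ d23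
  have p31 := fim_dst_pos _ _ d31
  obtain ⟨J, hJ⟩ : ∃ J, J = (1 - u1 * u2 - v1 * v2) / dst (a * u1, b * v1) (a * u2, b * v2) :=
    ⟨_, rfl⟩
  have J12 : 1 - u1 * u2 - v1 * v2 = J * dst (a * u1, b * v1) (a * u2, b * v2) := by
    rw [hJ]; exact (div_mul_cancel₀ _ p12.ne').symm
  have J23 : 1 - u2 * u3 - v2 * v3 = J * dst (a * u2, b * v2) (a * u3, b * v3) := by
    have : J = (1 - u2 * u3 - v2 * v3) / dst (a * u2, b * v2) (a * u3, b * v3) := by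
      rw [hJ]; linear_combination -r2
    rw [this]; exact (div_mul_cancel₀ _ p23.ne').symm
  have J31 : 1 - u3 * u1 - v3 * v1 = J * dst (a * u3, b * v3) (a * u1, b * v1) := by
    have : J = (1 - u1 * u3 - v1 * v3) / dst (a * u3, b * v3) (a * u1, b * v1) := by
      rw [hJ]; linear_combination r1
    rw [this, div_mul_cancel₀ _ p31.ne']; ring
  obtain ⟨n12, D12, b12⟩ := fim_bilinear a b c J _ _ _ _ hc2 c1 c2 d12 J12
  obtain ⟨n23, D23, b23⟩ := fim_bilinear a b c J _ _ _ _ hc2 c2 c3 d23 J23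
  obtain ⟨n31, D31, b31⟩ := fim_bilinear a b c J _ _ _ _ hc2 c3 c1 d31 J31
  have Jpos : 0 < J := by rw [hJ]; positivity
  obtain ⟨m, hm⟩ : ∃ m, m = J ^ 2 * c ^ 2 := ⟨_, rfl⟩
  rw [← hm] at b12 b23 b31
  obtain ⟨p, q, hpq, hu, hv, h4, h5, hp, hq, hC⟩ :=
    fim_poncelet u1 u2 u3 v1 v2 v3 m _ c1 c2 c3 n12 n23 n31 b12 b23 b31
  -- normalize
  obtain ⟨e, rfl⟩ : ∃ e, c = e * a := ⟨c / a, by field_simp⟩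
  obtain ⟨β, rfl⟩ : ∃ β, b = β * a := ⟨b / a, by field_simp⟩
  have e0 : 0 < e := pos_of_mul_pos_left hc0 ha.le
  have β0 : 0 < β := pos_of_mul_pos_left hb ha.le
  have hB : β ^ 2 = 1 - e ^ 2 := by
    apply mul_left_cancel₀ (pow_ne_zero 2 ha.ne'); linear_combination hc2
  have e1 : e < 1 := fim_e_lt e (by linarith [pow_pos β0 2])
  have m0 : 0 < m := by rw [hm]; positivity
  have hE : e ^ 2 * ((3 - m) * (1 + m)) = 4 * m := by
    have h : 3 - m ^ 2 = 2 * J ^ 2 * (a ^ 2 + (β * a) ^ 2) := by linear_combination hC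
    have h' : (β * a) ^ 2 = a ^ 2 * (1 - e ^ 2) := by rw [mul_pow, hB]; ring
    rw [h'] at h
    linear_combination e ^ 2 * h + (2 * e ^ 2 - 4) * hm
  have m1 : m < 1 := fim_m_lt m e m0 e0 e1 hE
  have h3m : 0 < 3 - m := by linarith
  have h1m : 0 < 1 - m := by linarith
  have l12 := fim_side m _ e _ _ _ _ m0 hE hC b12
  have l23 := fim_side m _ e _ _ _ _ m0 hE hC b23
  have l31 := fim_side m _ e _ _ _ _ m0 hE hC b31
  have x1 := fim_pos u1 v1 e e0 e1 c1
  have x2 := fim_pos u2 v2 e e0 e1 c2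
  have x3 := fim_pos u3 v3 e e0 e1 c3
  obtain ⟨W0, circ⟩ := fim_circle u1 u2 u3 v1 v2 v3 m _ p q e (β ^ 2) m0 m1 e0 e1 hB hE c1 c2 c3
    b12 b23 b31 hpq hu hv h4 h5 hp hq hC _ _ _ _ _ _ _ rfl rfl rfl rfl rfl rfl rfl
  have R1 := fim_focal a β e u1 v1 hB c1
  have R2 := fim_focal a β e u2 v2 hB c2
  have R3 := fim_focal a β e u3 v3 hB c3
  have ra1 : 0 < a * (1 + e * u1) := by positivity
  have ra2 : 0 < a * (1 + e * u2) := by positivity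
  have ra3 : 0 < a * (1 + e * u3) := by positivity
  subst hf1
  have K12 := fim_dst_inva ρ _ _ (-(e * a), 0) (a * u1, β * a * v1) (a * u2, β * a * v2) ra1 ra2 R1 R2
  have K23 := fim_dst_inva ρ _ _ (-(e * a), 0) (a * u2, β * a * v2) (a * u3, β * a * v3) ra2 ra3 R2 R3
  have K31 := fim_dst_inva ρ _ _ (-(e * a), 0) (a * u3, β * a * v3) (a * u1, β * a * v1) ra3 ra1 R3 R1
  have E12 : dst (a * u1, β * a * v1) (a * u2, β * a * v2)
      = (3 - m) / 2 * (1 - (e * u1) * (e * u2)) / J := by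
    rw [← l12, J12]; exact (mul_div_cancel_left₀ _ Jpos.ne').symm
  have E23 : dst (a * u2, β * a * v2) (a * u3, β * a * v3)
      = (3 - m) / 2 * (1 - (e * u2) * (e * u3)) / J := by
    rw [← l23, J23]; exact (mul_div_cancel_left₀ _ Jpos.ne').symm
  have E31 : dst (a * u3, β * a * v3) (a * u1, β * a * v1)
      = (3 - m) / 2 * (1 - (e * u3) * (e * u1)) / J := by
    rw [← l31, J31]; exact (mul_div_cancel_left₀ _ Jpos.ne').symm
  rw [fim_mitten_scale (ρ ^ 2 * (3 - m) / (2 * J * a ^ 2 * ((1 + e * u1) * (1 + e * u2) * (1 + e * u3))))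
    ((1 + e * u1) * (1 - (e * u2) * (e * u3))) ((1 + e * u2) * (1 - (e * u3) * (e * u1)))
    ((1 + e * u3) * (1 - (e * u1) * (e * u2))) _ _ _ (by positivity)
    (by rw [K23, E23]; field_simp) (by rw [K31, E31]; field_simp) (by rw [K12, E12]; field_simp)]
  generalize (1 + e * u1) * (1 - (e * u2) * (e * u3)) = l1 at *
  generalize (1 + e * u2) * (1 - (e * u3) * (e * u1)) = l2 at *
  generalize (1 + e * u3) * (1 - (e * u1) * (e * u2)) = l3 at *
  generalize l1 * (l2 + l3 - l1) = w1 at *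
  generalize l2 * (l3 + l1 - l2) = w2 at *
  generalize l3 * (l1 + l2 - l3) = w3 at *
  have hδ' : δ = a ^ 2 * (1 + (m - 1) * e ^ 2 / 2) := by
    have hpos : 0 ≤ a ^ 2 * (1 + (m - 1) * e ^ 2 / 2) := by
      have := fim_delta_nonneg m e m0 (by linarith [pow_pos β0 2])
      positivity
    rw [hδ, ← Real.sqrt_sq hpos]
    congr 1
    have h' : (β * a) ^ 2 = a ^ 2 * (1 - e ^ 2) := by rw [mul_pow, hB]; ring
    have h'' : (β * a) ^ 4 = (a ^ 2 * (1 - e ^ 2)) ^ 2 := by rw [← h']; ring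
    rw [h', h'']
    linear_combination a ^ 4 * e ^ 2 / 4 * hE
  have hR : ρ ^ 2 * (2 * a ^ 2 - (β * a) ^ 2 - δ) / (2 * a * (β * a) ^ 2) =
      ρ ^ 2 / a * (m * (3 - m) / ((3 + m) * (1 - m))) := by
    have B0 : β ^ 2 * ((3 - m) * (1 + m)) = (3 + m) * (1 - m) := by
      rw [hB]; linear_combination -hE
    have B1 : β ^ 2 = (3 + m) * (1 - m) / ((3 - m) * (1 + m)) := by
      rw [← B0]; field_simp
    have E1 : e ^ 2 = 4 * m / ((3 - m) * (1 + m)) := by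
      rw [← hE]; field_simp
    rw [hδ', mul_pow, E1, B1]; field_simp; ring
  rw [hR, dst, hC9]
  have hpos : 0 ≤ ρ ^ 2 / a * (m * (3 - m) / ((3 + m) * (1 - m))) := by positivity
  rw [← Real.sqrt_sq hpos, mul_pow (ρ ^ 2 / a), ← circ]
  congr 1
  simp only [bary, inva, Prod.fst_add, Prod.snd_add, Prod.smul_fst, Prod.smul_snd,
    Prod.fst_sub, Prod.snd_sub, smul_eq_mul] at R1 R2 R3 ⊢
  rw [R1, R2, R3]
  exact fim_end a ρ e β u1 u2 u3 v1 v2 v3 w1 w2 w3 ha.ne' β0.ne' x1.ne' x2.ne' x3.ne' W0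
end
end
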